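/- arXiv:math/0612582 — 2 statements merged into one kernel-verified Lean document; each statement's English description precedes it below -/
import Mathlib

section
/- The Milnor number of any singular point other than O on a normalized non-degenerate monoid surface of degree d is at most d(d−1) − 1. -/
open MvPolynomial
variable {K : Type*} [Field K]

def SingularAt {R : Type*} [CommRing R] {n : ℕ} (F : MvPolynomial (Fin (n + 1)) R)
    (P : Fin (n + 1) → R) : Prop :=
  eval P F = 0 ∧ ∀ i, eval P (pderiv i F) = 0

noncomputable def localEq (F : MvPolynomial (Fin 4) K) (P : Fin 4 → K) (r : Fin 4) :
    MvPolynomial (Fin 3) K :=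
  aeval (r.succAboveCases (1 : MvPolynomial (Fin 3) K)
    (fun j => C (P (r.succAbove j) / P r) + X j)) F

/-- The Milnor number of the germ at the origin defined by `g`. -/
noncomputable def milnorNumber (g : MvPolynomial (Fin 3) K) : ℕ :=
  Module.finrank K (MvPowerSeries (Fin 3) K ⧸
    Ideal.span (Set.range fun j : Fin 3 =>
      ((pderiv j g : MvPolynomial (Fin 3) K) : MvPowerSeries (Fin 3) K)))


lemma finrank_hom (K : Type*) [Field K] (n : ℕ) :
    Module.finrank K (homogeneousSubmodule (Fin 3) K n) = (n + 2).choose 2 := by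
  classical
  rw [homogeneousSubmodule_eq_finsupp_supported]
  have e := (AddMonoidAlgebra.supportedEquivFinsupp (R := K) (S := K) {d : Fin 3 →₀ ℕ | d.degree = n})
  have hs : {d : Fin 3 →₀ ℕ | d.degree = n} = ((Finset.univ : Finset (Fin 3)).finsuppAntidiag n : Set (Fin 3 →₀ ℕ)) := by
    ext x
    simp [Finset.mem_finsuppAntidiag, Finsupp.degree_eq_sum]
  refine e.finrank_eq.trans ?_
  rw [hs, Module.finrank_finsupp_self, ← Nat.card_eq_fintype_card, Nat.card_eq_card_toFinset, Finset.toFinset_coe, Finset.card_finsuppAntidiag_nat_eq_choose]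
  simp
  rw [add_comm 2 n, Nat.choose_symm_add]

instance (K : Type*) [Field K] (n : ℕ) : Module.Finite K (homogeneousSubmodule (Fin 3) K n) :=
  Module.Finite.iff_fg.mpr (homogeneousSubmodule_fg _ _ _)

lemma hom_factor {K : Type*} [Field K] {g A : MvPolynomial (Fin 3) K} {d n : ℕ}
    (hg : g.IsHomogeneous d) (hA : A.IsHomogeneous (d + n)) (h : g ∣ A) :
    ∃ C : MvPolynomial (Fin 3) K, C.IsHomogeneous n ∧ A = g * C := by
  obtain ⟨C, rfl⟩ := h
  let _ : GradedAlgebra (homogeneousSubmodule (Fin 3) K) := MvPolynomial.gradedAlgebra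
  have h1 := DirectSum.coe_decompose_mul_add_of_left_mem (homogeneousSubmodule (Fin 3) K)
    (i := d) (j := n) (a := g) (b := C) hg
  rw [DirectSum.decompose_of_mem_same (homogeneousSubmodule (Fin 3) K) hA] at h1
  exact ⟨_, (DirectSum.decompose (homogeneousSubmodule (Fin 3) K) C n).2, h1⟩

lemma taylor {K : Type*} [Field K] {B : Type*} [CommRing B] [Algebra K B] {n : ℕ} (J : Ideal B)
    (x y : Fin n → B) (hy : ∀ j, y j ∈ J) (p : MvPolynomial (Fin n) K) :
    aeval (x + y) p - (aeval x p + ∑ j, y j * aeval x (pderiv j p)) ∈ J ^ 2 := by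
  induction p using MvPolynomial.induction_on with
  | C a => simp
  | add p q hp hq =>
    convert add_mem hp hq using 1
    simp only [map_add, mul_add, Finset.sum_add_distrib]; ring
  | mul_X p i hp =>
    have h1 := Ideal.mul_mem_right (x i + y i) _ hp
    have h2 : (∑ j, y j * aeval x (pderiv j p)) * y i ∈ J ^ 2 := by
      rw [pow_two]
      exact Ideal.mul_mem_mul (Ideal.sum_mem _ fun j _ => Ideal.mul_mem_right _ _ (hy j)) (hy i)
    convert add_mem h1 h2 using 1
    have : ∑ j, y j * aeval x (pderiv j (p * X i)) = x i * (∑ j, y j * aeval x (pderiv j p)) + y i * aeval x p := by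
      simp only [pderiv_mul, pderiv_X, map_add, map_mul, aeval_X, mul_add, Finset.sum_add_distrib, Finset.mul_sum]
      congr 1
      · refine Finset.sum_congr rfl fun j _ => by ring
      · rw [Finset.sum_eq_single i]
        · simp
        · intro b _ hb
          simp [Pi.single_eq_of_ne' hb]
        · simp
    rw [this]
    simp only [map_mul, aeval_X, Pi.add_apply]
    ring

lemma chainD {K : Type*} [Field K] {B : Type*} [CommRing B] [Algebra K B] (D : Derivation K B B)
    {n : ℕ} (φ : Fin n → B) (p : MvPolynomial (Fin n) K) :
    D (aeval φ p) = ∑ j, aeval φ (pderiv j p) * D (φ j) := by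
  induction p using MvPolynomial.induction_on with
  | C a => simp
  | add p q hp hq =>
    simp [hp, hq, add_mul, Finset.sum_add_distrib]
  | mul_X p i hp =>
    have : ∀ j, aeval φ (pderiv j (p * X i)) * D (φ j)
        = (aeval φ (pderiv j p) * D (φ j)) * φ i +
          (if j = i then aeval φ p * D (φ j) else 0) := by
      intro j
      rw [pderiv_mul, map_add, map_mul, map_mul, aeval_X, pderiv_X]
      by_cases h : j = i
      · subst h; simp; ring
      · rw [Pi.single_eq_of_ne' h, if_neg h]; simp; ring
    rw [Finset.sum_congr rfl fun j _ => this j, Finset.sum_add_distrib, ← Finset.sum_mul, ← hp]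
    simp only [map_mul, aeval_X, Derivation.leibniz, smul_eq_mul, Finset.sum_ite_eq',
      Finset.mem_univ, if_true]
    ring

lemma chain {K : Type*} [Field K] {n : ℕ} (φ : Fin n → Polynomial K) (p : MvPolynomial (Fin n) K) :
    Polynomial.derivative (aeval φ p) =
      ∑ j, aeval φ (pderiv j p) * Polynomial.derivative (φ j) :=
  chainD (Polynomial.derivative' : Derivation K (Polynomial K) (Polynomial K)) φ p

lemma pd_comm {K : Type*} [Field K] {n : ℕ} (i j : Fin n) (p : MvPolynomial (Fin n) K) :
    pderiv i (pderiv j p) = pderiv j (pderiv i p) := by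
  ext m
  simp only [coeff_pderiv]
  by_cases h : i = j
  · subst h; rfl
  · rw [add_right_comm]
    simp [h, Ne.symm h]
    ring

lemma bezout_curve {K : Type*} [Field K] {f g : MvPolynomial (Fin 3) K} {e d M : ℕ}
    (hf : f.IsHomogeneous e) (hg : g.IsHomogeneous d) (hg0 : g ≠ 0) (hrel : IsRelPrime f g)
    (φ : Fin 3 → Polynomial K) (l m : MvPolynomial (Fin 3) K) (hl : l.IsHomogeneous 1)
    (hm : m.IsHomogeneous 1) (hl0 : (aeval φ l).coeff 0 ≠ 0) (hm0 : (aeval φ m).coeff 0 = 0)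
    (hm1 : (aeval φ m).coeff 1 ≠ 0)
    (hfM : Polynomial.X ^ M ∣ aeval φ f) (hgM : Polynomial.X ^ M ∣ aeval φ g) : M ≤ e * d := by
  obtain ⟨w, hw⟩ := Polynomial.X_dvd_iff.mpr hm0
  have hw0 : w.coeff 0 ≠ 0 := by
    rw [hw, Polynomial.coeff_X_mul] at hm1; exact hm1
  set n := M + e + d with hn
  -- surjectivity
  have hsurj : ∀ s : Polynomial K, ∀ j ≤ M, ∃ G : MvPolynomial (Fin 3) K, G.IsHomogeneous n ∧
      Polynomial.X ^ j ∣ aeval φ G - s := by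
    intro s j
    induction j with
    | zero => intro _; exact ⟨0, isHomogeneous_zero _ _ _, by simp⟩
    | succ j ih =>
      intro hj
      obtain ⟨G, hG, q, hq⟩ := ih (by omega)
      set w' := w ^ j * (aeval φ l) ^ (n - j) with hw'
      have hwp0 : w'.coeff 0 ≠ 0 := by
        simp only [hw', Polynomial.coeff_zero_eq_eval_zero, Polynomial.eval_mul,
          Polynomial.eval_pow] at *
        exact mul_ne_zero (pow_ne_zero _ hw0) (pow_ne_zero _ hl0)
      have hmon : (m ^ j * l ^ (n - j)).IsHomogeneous n := by
        have := (hm.pow j).mul (hl.pow (n - j))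
        rwa [show 1 * j + 1 * (n - j) = n by omega] at this
      refine ⟨G - C (q.coeff 0 / w'.coeff 0) * (m ^ j * l ^ (n - j)), hG.sub (hmon.C_mul _), ?_⟩
      have h1 : aeval φ (G - C (q.coeff 0 / w'.coeff 0) * (m ^ j * l ^ (n - j))) - s
          = Polynomial.X ^ j * (q - Polynomial.C (q.coeff 0 / w'.coeff 0) * w') := by
        rw [map_sub, map_mul, map_mul, map_pow, map_pow, hw, algHom_C,
          Polynomial.algebraMap_eq, mul_pow, mul_sub, ← hq, hw']
        ring
      rw [h1, pow_succ]
      apply mul_dvd_mul_left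
      rw [Polynomial.X_dvd_iff]
      simp [div_mul_cancel₀ _ hwp0]
  let V := fun n => homogeneousSubmodule (Fin 3) K n
  let T : V n →ₗ[K] (Fin M → K) :=
    LinearMap.pi fun i => (Polynomial.lcoeff K (i : ℕ)) ∘ₗ (aeval φ).toLinearMap ∘ₗ (V n).subtype
  have hT : Function.Surjective T := by
    intro c
    obtain ⟨G, hG, hd⟩ := hsurj (∑ i : Fin M, Polynomial.monomial (i : ℕ) (c i)) M le_rfl
    refine ⟨⟨G, hG⟩, ?_⟩
    ext i
    rw [Polynomial.X_pow_dvd_iff] at hd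
    have := hd i i.2
    rw [Polynomial.coeff_sub, sub_eq_zero] at this
    change (aeval φ G).coeff i = c i
    rw [this, Polynomial.finsetSum_coeff, Finset.sum_eq_single i]
    · simp
    · intro b _ hb
      rw [Polynomial.coeff_monomial, if_neg]
      exact fun h => hb (Fin.ext h)
    · simp
  have r1 := LinearMap.finrank_range_add_finrank_ker T
  rw [LinearMap.range_eq_top.mpr hT, finrank_top, Module.finrank_fin_fun] at r1
  let S : (V (M + d) × V (M + e)) →ₗ[K] V n :=
    LinearMap.codRestrict (V n)
      ((LinearMap.mulLeft K f ∘ₗ (V (M + d)).subtype).coprod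
        (LinearMap.mulLeft K g ∘ₗ (V (M + e)).subtype)) (by
        rintro ⟨A, B⟩
        have h1 := hf.mul A.2
        have h2 := hg.mul B.2
        rw [show e + (M + d) = n by omega] at h1
        rw [show d + (M + e) = n by omega] at h2
        exact h1.add h2)
  have hS : LinearMap.range S ≤ LinearMap.ker T := by
    rintro _ ⟨⟨A, B⟩, rfl⟩
    rw [LinearMap.mem_ker]
    ext i
    change (aeval φ (f * A.1 + g * B.1)).coeff i = 0
    have : Polynomial.X ^ M ∣ aeval φ (f * A.1 + g * B.1) := by
      rw [map_add, map_mul, map_mul]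
      exact dvd_add (hfM.mul_right _) (hgM.mul_right _)
    exact Polynomial.X_pow_dvd_iff.mp this i i.2
  have r2 := LinearMap.finrank_range_add_finrank_ker S
  have r3 := Submodule.finrank_mono hS
  let U : V M →ₗ[K] (V (M + d) × V (M + e)) :=
    LinearMap.prod
      (LinearMap.codRestrict (V (M + d)) (LinearMap.mulLeft K g ∘ₗ (V M).subtype) (by
        intro A
        have := hg.mul A.2
        rw [add_comm d M] at this
        exact this))
      (LinearMap.codRestrict (V (M + e)) (LinearMap.mulLeft K (-f) ∘ₗ (V M).subtype) (by
        intro A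
        have := hf.neg.mul A.2
        rw [add_comm e M] at this
        exact this))
  have hU : LinearMap.ker S ≤ LinearMap.range U := by
    rintro ⟨A, B⟩ hAB
    have h0 : f * A.1 + g * B.1 = 0 := congrArg Subtype.val (LinearMap.mem_ker.mp hAB)
    have hA : A.1.IsHomogeneous (M + d) := A.2
    have hdv : g ∣ A.1 := by
      refine hrel.symm.dvd_of_dvd_mul_left (y := f) ⟨-B.1, ?_⟩
      linear_combination h0
    obtain ⟨C, hC, hAC⟩ := hom_factor hg (n := M) (add_comm M d ▸ hA) hdv
    refine ⟨⟨C, hC⟩, ?_⟩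
    refine Prod.ext (Subtype.ext hAC.symm) (Subtype.ext ?_)
    change -f * C = B.1
    apply mul_left_cancel₀ hg0
    rw [hAC] at h0
    linear_combination -h0
  have r4 := Submodule.finrank_mono hU
  have r5 := LinearMap.finrank_range_le U
  rw [Module.finrank_prod] at r2
  simp only [V, finrank_hom] at r1 r2 r3 r4 r5
  have ch : ∀ x : ℕ, 2 * (x + 2).choose 2 = (x + 2) * (x + 1) := by
    intro x
    have := Nat.add_one_mul_choose_eq (x + 1) 1
    simp at this
    linarith
  have c1 : 2 * (n + 2).choose 2 = (M + e + d + 2) * (M + e + d + 1) := ch n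
  have c2 := ch (M + d)
  have c3 := ch (M + e)
  have c4 := ch M
  nlinarith

lemma abs_curve {K : Type*} [Field K] {A : Type*} [CommRing A] [Algebra K A] [IsLocalRing A]
    [Module.Finite K A] (x : Fin 3 → A)
    (hm : IsLocalRing.maximalIdeal A = Ideal.span (Set.range x))
    (hres : ∀ s : A, ∃ c : K, s - algebraMap K A c ∈ IsLocalRing.maximalIdeal A)
    (p : Fin 3 → MvPolynomial (Fin 3) K) (hp0 : ∀ i, eval 0 (p i) = 0)
    (hp : ∀ i, aeval x (p i) = 0) (Q : Matrix (Fin 3) (Fin 3) K)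
    (hQ : ∀ i j, Q i j = eval 0 (pderiv j (p i))) (hrk : 2 ≤ Q.rank)
    (hk : 2 ≤ Module.finrank K A) :
    ∃ φ : Fin 3 → Polynomial K, (∀ i, (φ i).coeff 0 = 0) ∧ (∃ i, (φ i).coeff 1 ≠ 0) ∧
      ∀ i, Polynomial.X ^ (Module.finrank K A) ∣ aeval φ (p i) := by
  set m := IsLocalRing.maximalIdeal A with hmdef
  have hart : IsArtinianRing A := IsArtinianRing.of_finite K A
  have hxm : ∀ j, x j ∈ m := fun j => hm ▸ Ideal.subset_span ⟨j, rfl⟩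
  have hev : ∀ q : MvPolynomial (Fin 3) K, aeval (0 : Fin 3 → A) q = algebraMap K A (eval 0 q) := by
    intro q
    have h := aeval_algebraMap_apply (A := K) A (0 : Fin 3 → K) q
    rw [← coe_aeval_eq_eval, RingHom.coe_coe, ← h]
    congr 2
    ext; simp
  have hrow : ∀ i, ∑ j, Q i j • x j ∈ m ^ 2 := by
    intro i
    have h := taylor m (0 : Fin 3 → A) x hxm (p i)
    rw [zero_add, hp, hev, hp0, map_zero, zero_add, zero_sub, neg_mem_iff] at h
    convert h using 2 with j
    rw [hev, hQ, Algebra.smul_def, mul_comm]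
  let ψ : (Fin 3 → K) →ₗ[K] A := Fintype.linearCombination K x
  let S : Submodule K (Fin 3 → K) := ((m ^ 2).restrictScalars K).comap ψ
  have hrS : Submodule.span K (Set.range Q.row) ≤ S := by
    rw [Submodule.span_le]
    rintro _ ⟨i, rfl⟩
    exact hrow i
  have hfr : Module.finrank K ((Fin 3 → K) ⧸ S) ≤ 1 := by
    have h1 := Submodule.finrank_mono hrS
    have h2 := S.finrank_quotient_add_finrank
    rw [Q.rank_eq_finrank_span_row] at hrk
    simp at h2
    omega
  obtain ⟨v, hv⟩ := finrank_le_one_iff.mp hfr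
  obtain ⟨c0, rfl⟩ := S.mkQ_surjective v
  set τ := ψ c0 with hτ
  have hτm : τ ∈ m := by
    rw [hτ]
    simp only [ψ, Fintype.linearCombination_apply]
    refine Ideal.sum_mem _ fun j _ => ?_
    rw [Algebra.smul_def]
    exact Ideal.mul_mem_left _ _ (hxm j)
  have hle : m ≤ Ideal.span {τ} ⊔ m • m := by
    conv_lhs => rw [hm]
    rw [Ideal.span_le]
    rintro _ ⟨j, rfl⟩
    obtain ⟨a, ha⟩ := hv (S.mkQ (Pi.single j 1))
    rw [← map_smul, ← sub_eq_zero, ← map_sub, Submodule.mkQ_apply,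
      Submodule.Quotient.mk_eq_zero] at ha
    have ha' : ψ (a • c0 - Pi.single j 1) ∈ m ^ 2 := ha
    rw [map_sub, map_smul, ← hτ] at ha'
    have hs : ψ (Pi.single j 1) = x j := by simp [ψ, Fintype.linearCombination_apply_single]
    rw [hs] at ha'
    have : x j = a • τ - (a • τ - x j) := by ring
    rw [this]
    refine sub_mem (Ideal.mem_sup_left ?_) (Ideal.mem_sup_right ?_)
    · rw [Algebra.smul_def]
      exact Ideal.mul_mem_left _ _ (Ideal.mem_span_singleton_self _)
    · rwa [smul_eq_mul, ← pow_two]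
  have hmτ : m ≤ Ideal.span {τ} :=
    Submodule.le_of_le_smul_of_le_jacobson_bot (IsNoetherian.noetherian m)
      (IsLocalRing.maximalIdeal_le_jacobson ⊥) hle
  -- nilpotency
  obtain ⟨N, hN⟩ : IsNilpotent τ := by
    exact Ring.KrullDimLE.isNilpotent_iff_mem_maximalIdeal.mpr hτm
  have hstep : ∀ (n : ℕ) (s : A), ∃ q : Polynomial K, ∃ s' : A,
      s = Polynomial.aeval τ q + τ ^ n * s' := by
    intro n
    induction n with
    | zero => intro s; exact ⟨0, s, by simp⟩
    | succ n ih =>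
      intro s
      obtain ⟨q, s', h⟩ := ih s
      obtain ⟨c, hc⟩ := hres s'
      obtain ⟨t, ht⟩ := Ideal.mem_span_singleton'.mp (hmτ hc)
      refine ⟨q + Polynomial.C c * Polynomial.X ^ n, t, ?_⟩
      rw [h, map_add, map_mul, map_pow, Polynomial.aeval_C, Polynomial.aeval_X]
      linear_combination -(τ ^ n) * ht
  have hsurj : ∀ s : A, ∃ q : Polynomial K, Polynomial.aeval τ q = s := by
    intro s
    obtain ⟨q, s', h⟩ := hstep N s
    exact ⟨q, by rw [h, hN]; simp⟩
  -- minimal polynomial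
  have hτint : IsIntegral K τ := Algebra.IsIntegral.isIntegral τ
  obtain ⟨j, hj⟩ : ∃ j, minpoly K τ = Polynomial.X ^ j := by
    have : minpoly K τ ∣ Polynomial.X ^ N := minpoly.dvd _ _ (by simp [hN])
    obtain ⟨j, _, hj⟩ := (dvd_prime_pow Polynomial.prime_X _).mp this
    exact ⟨j, Polynomial.eq_of_monic_of_associated (minpoly.monic hτint)
      (Polynomial.monic_X_pow j) hj⟩
  have hτj : τ ^ j = 0 := by
    have := minpoly.aeval K τ
    rw [hj] at this
    simpa using this
  have hkj : Module.finrank K A ≤ j := by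
    have hspan : Submodule.span K (Set.range fun i : Fin j => τ ^ (i : ℕ)) = ⊤ := by
      rw [eq_top_iff]
      intro s _
      obtain ⟨q, rfl⟩ := hsurj s
      rw [Polynomial.aeval_eq_sum_range]
      refine Submodule.sum_mem _ fun i _ => Submodule.smul_mem _ _ ?_
      by_cases hi : i < j
      · exact Submodule.subset_span ⟨⟨i, hi⟩, rfl⟩
      · rw [pow_eq_zero_of_le (not_lt.mp hi) hτj]
        exact zero_mem _
    have := finrank_range_le_card (R := K) (fun i : Fin j => τ ^ (i : ℕ))
    rw [Set.finrank, hspan, finrank_top, Fintype.card_fin] at this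
    exact this
  choose φ hφ using fun i => hsurj (x i)
  have hφ0 : ∀ i, (φ i).coeff 0 = 0 := by
    intro i
    by_contra h
    have h1 := hφ i
    rw [← Polynomial.X_mul_divX_add (φ i), map_add, map_mul, Polynomial.aeval_X,
      Polynomial.aeval_C] at h1
    have h2 : algebraMap K A ((φ i).coeff 0) ∈ m := by
      rw [← eq_sub_iff_add_eq'] at h1
      rw [h1]
      exact sub_mem (hxm i) (Ideal.mul_mem_right _ _ hτm)
    exact (IsLocalRing.mem_maximalIdeal _).mp h2 ((IsUnit.mk0 _ h).map (algebraMap K A))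
  refine ⟨φ, hφ0, ?_, ?_⟩
  · by_contra! h
    have hm2 : m ≤ Ideal.span {τ ^ 2} := by
      rw [hm, Ideal.span_le]
      rintro _ ⟨i, rfl⟩
      have : Polynomial.X ^ 2 ∣ φ i := by
        rw [Polynomial.X_pow_dvd_iff]
        intro d hd
        interval_cases d
        · exact hφ0 i
        · exact h i
      obtain ⟨q, hq⟩ := this
      rw [← hφ i, hq, map_mul, map_pow, Polynomial.aeval_X]
      exact Ideal.mul_mem_right _ _ (Ideal.mem_span_singleton_self _)
    obtain ⟨t, ht⟩ := Ideal.mem_span_singleton'.mp (hm2 hτm)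
    have hu : IsUnit (1 - t * τ) :=
      (IsLocalRing.isUnit_one_sub_self_of_mem_nonunits _
        ((IsLocalRing.mem_maximalIdeal _).mp (Ideal.mul_mem_left _ t hτm)))
    have h0 : τ = 0 := by
      have : (1 - t * τ) * τ = 0 := by linear_combination -ht
      exact (hu.mul_right_eq_zero).mp this
    have : minpoly K τ ∣ Polynomial.X := minpoly.dvd _ _ (by simp [h0])
    rw [hj] at this
    have := Polynomial.natDegree_le_of_dvd this Polynomial.X_ne_zero
    simp at this
    omega
  · intro i
    have h1 : Polynomial.aeval τ (aeval φ (p i)) = 0 := by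
      have := (MvPolynomial.comp_aeval_apply φ (Polynomial.aeval τ) (p i))
      rw [this]
      simp only [hφ]
      exact hp i
    have := minpoly.dvd _ _ h1
    rw [hj] at this
    exact (pow_dvd_pow _ hkj).trans this

lemma mem_span_X {K : Type*} [Field K] (s : MvPowerSeries (Fin 3) K)
    (hs : MvPowerSeries.constantCoeff s = 0) :
    s ∈ Ideal.span (Set.range (MvPowerSeries.X : Fin 3 → MvPowerSeries (Fin 3) K)) := by
  classical
  let s0 : MvPowerSeries (Fin 3) K := fun n => if n 0 = 0 then 0 else MvPowerSeries.coeff n s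
  let s1 : MvPowerSeries (Fin 3) K := fun n =>
    if n 0 = 0 then (if n 1 = 0 then 0 else MvPowerSeries.coeff n s) else 0
  let s2 : MvPowerSeries (Fin 3) K := fun n =>
    if n 0 = 0 then (if n 1 = 0 then (if n 2 = 0 then 0 else MvPowerSeries.coeff n s) else 0) else 0
  have e0 : ∀ n, MvPowerSeries.coeff n s0 = if n 0 = 0 then 0 else MvPowerSeries.coeff n s :=
    fun n => rfl
  have e1 : ∀ n, MvPowerSeries.coeff n s1 =
    if n 0 = 0 then (if n 1 = 0 then 0 else MvPowerSeries.coeff n s) else 0 := fun n => rfl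
  have e2 : ∀ n, MvPowerSeries.coeff n s2 =
    if n 0 = 0 then (if n 1 = 0 then (if n 2 = 0 then 0 else MvPowerSeries.coeff n s) else 0)
      else 0 := fun n => rfl
  have hsum : s = s0 + s1 + s2 := by
    ext n
    rw [map_add, map_add, e0, e1, e2]
    by_cases h0 : n 0 = 0 <;> by_cases h1 : n 1 = 0 <;> by_cases h2 : n 2 = 0 <;> simp [h0, h1, h2]
    have : n = 0 := by ext i; fin_cases i <;> simp [h0, h1, h2]
    rw [this]
    exact hs
  have hd : ∀ (i : Fin 3) (t : MvPowerSeries (Fin 3) K), MvPowerSeries.X i ∣ t →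
      t ∈ Ideal.span (Set.range (MvPowerSeries.X : Fin 3 → MvPowerSeries (Fin 3) K)) := by
    rintro i _ ⟨t, rfl⟩
    exact Ideal.mul_mem_right _ _ (Ideal.subset_span ⟨i, rfl⟩)
  rw [hsum]
  refine add_mem (add_mem (hd 0 _ ?_) (hd 1 _ ?_)) (hd 2 _ ?_) <;>
    rw [MvPowerSeries.X_dvd_iff] <;> intro n hn <;>
    simp [e0, e1, e2, hn]

lemma local_curve {K : Type*} [Field K] (H : MvPolynomial (Fin 3) K)
    (h1 : ∀ i, eval 0 (pderiv i H) = 0)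
    (Q : Matrix (Fin 3) (Fin 3) K)
    (hQ : ∀ i j, Q i j = eval 0 (pderiv j (pderiv i H))) (hrk : 2 ≤ Q.rank)
    (hk : 2 ≤ milnorNumber H) :
    ∃ φ : Fin 3 → Polynomial K, (∀ i, (φ i).coeff 0 = 0) ∧ (∃ i, (φ i).coeff 1 ≠ 0) ∧
      ∀ i, Polynomial.X ^ (milnorNumber H) ∣ aeval φ (pderiv i H) := by
  unfold milnorNumber at hk ⊢
  set J := Ideal.span (Set.range fun j : Fin 3 =>
      ((pderiv j H : MvPolynomial (Fin 3) K) : MvPowerSeries (Fin 3) K)) with hJ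
  have hfin : Module.Finite K (MvPowerSeries (Fin 3) K ⧸ J) :=
    Module.finite_of_finrank_pos (by omega)
  have hnt : Nontrivial (MvPowerSeries (Fin 3) K ⧸ J) :=
    Module.nontrivial_of_finrank_pos (R := K) (by omega)
  have hsj : Function.Surjective (Ideal.Quotient.mk J) := Ideal.Quotient.mk_surjective
  have hloc : IsLocalRing (MvPowerSeries (Fin 3) K ⧸ J) := IsLocalRing.of_surjective' _ hsj
  let x : Fin 3 → MvPowerSeries (Fin 3) K ⧸ J := fun i => Ideal.Quotient.mk J (MvPowerSeries.X i)
  have hspan : Ideal.span (Set.range x) = (Ideal.span (Set.range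
      (MvPowerSeries.X : Fin 3 → MvPowerSeries (Fin 3) K))).map (Ideal.Quotient.mk J) := by
    rw [Ideal.map_span, ← Set.range_comp]; rfl
  have hres : ∀ s : MvPowerSeries (Fin 3) K ⧸ J, ∃ c : K,
      s - algebraMap K _ c ∈ Ideal.span (Set.range x) := by
    intro s
    obtain ⟨s, rfl⟩ := hsj s
    refine ⟨MvPowerSeries.constantCoeff s, ?_⟩
    rw [hspan]
    have := Ideal.mem_map_of_mem (Ideal.Quotient.mk J)
      (mem_span_X (s - MvPowerSeries.C (MvPowerSeries.constantCoeff s)) (by simp))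
    rw [map_sub] at this
    exact this
  have hxnon : ∀ i, x i ∈ IsLocalRing.maximalIdeal (MvPowerSeries (Fin 3) K ⧸ J) := by
    intro i
    rw [IsLocalRing.mem_maximalIdeal]
    intro hu
    have hl : IsLocalHom (Ideal.Quotient.mk J) := IsLocalHom.of_surjective _ hsj
    have := hl.map_nonunit _ hu
    rw [MvPowerSeries.isUnit_iff_constantCoeff] at this
    simp at this
  have hm : IsLocalRing.maximalIdeal (MvPowerSeries (Fin 3) K ⧸ J) = Ideal.span (Set.range x) := by
    have hle : Ideal.span (Set.range x) ≤ IsLocalRing.maximalIdeal _ := by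
      rw [Ideal.span_le]
      rintro _ ⟨i, rfl⟩
      exact hxnon i
    refine le_antisymm ?_ hle
    intro s hs
    obtain ⟨c, hc⟩ := hres s
    have hcm : algebraMap K _ c ∈ IsLocalRing.maximalIdeal (MvPowerSeries (Fin 3) K ⧸ J) := by
      have := sub_mem hs (hle hc)
      rwa [sub_sub_cancel] at this
    have hc0 : c = 0 := by
      by_contra h
      exact (IsLocalRing.mem_maximalIdeal _).mp hcm ((IsUnit.mk0 _ h).map (algebraMap K _))
    simpa [hc0] using hc
  refine abs_curve x hm (hm ▸ hres) (fun i => pderiv i H) h1 ?_ Q hQ hrk hk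
  intro i
  have : ∀ q : MvPolynomial (Fin 3) K, aeval x q = Ideal.Quotient.mk J (q : MvPowerSeries (Fin 3) K) := by
    intro q
    have : aeval x = (Ideal.Quotient.mkₐ K J).comp (MvPolynomial.coeToMvPowerSeries.algHom K) := by
      ext i
      simp [x]
    rw [this]
    simp
  rw [this, Ideal.Quotient.eq_zero_iff_mem]
  exact Ideal.subset_span ⟨i, rfl⟩

lemma coeff0_aeval {n : ℕ} (Φ : Fin n → Polynomial K) (p : MvPolynomial (Fin n) K) :
    (aeval Φ p).coeff 0 = eval (fun i => (Φ i).coeff 0) p := by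
  have h : (Polynomial.evalRingHom (0 : K)).comp (aeval Φ : _ →ₐ[K] Polynomial K).toRingHom
      = eval (fun i => (Φ i).coeff 0) := by
    apply MvPolynomial.ringHom_ext
    · intro c; simp
    · intro i; simp [Polynomial.coeff_zero_eq_eval_zero]
  have := congrArg (fun h => h p) h
  simpa [Polynomial.coeff_zero_eq_eval_zero] using this

lemma coeff1_aeval {n : ℕ} (Φ : Fin n → Polynomial K) (p : MvPolynomial (Fin n) K) :
    (aeval Φ p).coeff 1 =
      ∑ j, eval (fun i => (Φ i).coeff 0) (pderiv j p) * (Φ j).coeff 1 := by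
  have h := congrArg (fun q => Polynomial.coeff q 0) (chain Φ p)
  simpa [Polynomial.coeff_derivative, Polynomial.finsetSum_coeff, Polynomial.mul_coeff_zero,
    coeff0_aeval] using h

/-- The monoid polynomial. -/
noncomputable def monF (f g : MvPolynomial (Fin 3) K) : MvPolynomial (Fin 4) K :=
  X 0 * rename Fin.succ f + rename Fin.succ g

lemma monF_hom {f g : MvPolynomial (Fin 3) K} {d : ℕ} (hd : 1 ≤ d)
    (hf : f.IsHomogeneous (d - 1)) (hg : g.IsHomogeneous d) : (monF f g).IsHomogeneous d := by
  have h1 := (isHomogeneous_X K (0 : Fin 4)).mul (hf.rename_isHomogeneous (f := Fin.succ))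
  rw [show 1 + (d - 1) = d by omega] at h1
  exact h1.add hg.rename_isHomogeneous

lemma pderiv_zero_ren (p : MvPolynomial (Fin 3) K) :
    pderiv (0 : Fin 4) (rename Fin.succ p) = 0 := by
  classical
  apply pderiv_eq_zero_of_notMem_vars
  intro h
  have := vars_rename Fin.succ p h
  simp at this

lemma monF_d0 (f g : MvPolynomial (Fin 3) K) : pderiv 0 (monF f g) = rename Fin.succ f := by
  simp [monF, pderiv_zero_ren]

lemma monF_ds (f g : MvPolynomial (Fin 3) K) (i : Fin 3) :
    pderiv i.succ (monF f g) = monF (pderiv i f) (pderiv i g) := by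
  have hX : pderiv i.succ (X 0 : MvPolynomial (Fin 4) K) = 0 :=
    pderiv_X_of_ne (Fin.succ_ne_zero i).symm
  simp [monF, pderiv_rename (Fin.succ_injective 3), hX]

lemma eval_monF (f g : MvPolynomial (Fin 3) K) (R : Fin 4 → K) :
    eval R (monF f g) = R 0 * eval (R ∘ Fin.succ) f + eval (R ∘ Fin.succ) g := by
  simp [monF, eval_rename]

lemma aeval_monF {B : Type*} [CommRing B] [Algebra K B] (f g : MvPolynomial (Fin 3) K)
    (R : Fin 4 → B) :
    aeval R (monF f g) = R 0 * aeval (R ∘ Fin.succ) f + aeval (R ∘ Fin.succ) g := by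
  simp [monF, aeval_rename]

lemma euler_aeval {n e : ℕ} {B : Type*} [CommRing B] [Algebra K B] {p : MvPolynomial (Fin n) K}
    (hp : p.IsHomogeneous e) (R : Fin n → B) :
    ∑ i, R i * aeval R (pderiv i p) = e * aeval R p := by
  have := congrArg (aeval R) hp.sum_X_mul_pderiv
  simpa [map_sum] using this

lemma euler_eval {n e : ℕ} {p : MvPolynomial (Fin n) K}
    (hp : p.IsHomogeneous e) (R : Fin n → K) :
    ∑ i, R i * eval R (pderiv i p) = e * eval R p := by
  have := congrArg (eval R) hp.sum_X_mul_pderiv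
  simpa [map_sum] using this

/-- Kernel vectors of the Hessian with trivial last three coordinates vanish. -/
lemma ker_hess {f g : MvPolynomial (Fin 3) K} {R : Fin 4 → K} {i0 : Fin 3}
    (hi0 : eval (R ∘ Fin.succ) (pderiv i0 f) ≠ 0) (C : Fin 4 → K)
    (hC : ∀ i, ∑ j, eval R (pderiv j (pderiv i (monF f g))) * C j = 0)
    (h0 : ∀ j : Fin 3, C j.succ = 0) : C = 0 := by
  have h := hC i0.succ
  rw [Fin.sum_univ_succ, Finset.sum_eq_zero (fun j _ => by rw [h0, mul_zero]), add_zero, monF_ds,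
    monF_d0, eval_rename] at h
  have h1 : C 0 = 0 := (mul_eq_zero.mp h).resolve_left hi0
  ext i
  refine Fin.cases h1 (fun j => h0 j) i

lemma core [CharZero K] {d k : ℕ} (hd : 3 ≤ d) (hk : 2 ≤ k)
    (f g : MvPolynomial (Fin 3) K)
    (hf : f.IsHomogeneous (d - 1)) (hg : g.IsHomogeneous d) (hg0 : g ≠ 0)
    (hrel : IsRelPrime f g) (R : Fin 4 → K) (ha : R ∘ Fin.succ ≠ 0) (i0 : Fin 3)
    (hi0 : eval (R ∘ Fin.succ) (pderiv i0 f) ≠ 0)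
    (hR : eval R (monF f g) = 0) (hRi : ∀ i, eval R (pderiv i (monF f g)) = 0)
    (r : Fin 4) (hRr : R r = 1) (Φ : Fin 4 → Polynomial K) (hΦr : Φ r = 1)
    (hΦR : ∀ i, (Φ i).coeff 0 = R i) (hΦ1 : ∃ i, (Φ i).coeff 1 ≠ 0)
    (hdiv : ∀ i, i ≠ r → Polynomial.X ^ k ∣ aeval Φ (pderiv i (monF f g))) :
    k + 1 ≤ (d - 1) * d := by
  have hΦR' : (fun i => (Φ i).coeff 0) = R := funext hΦR
  have hFh := monF_hom (by omega) hf hg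
  set F := monF f g with hF
  -- step 1
  have s1 : Polynomial.X ^ k ∣ Polynomial.derivative (aeval Φ F) := by
    rw [chain]
    refine Finset.dvd_sum fun i _ => ?_
    by_cases h : i = r
    · subst h; rw [hΦr]; simp
    · exact (hdiv i h).mul_right _
  have s1' : Polynomial.X ^ (k + 1) ∣ aeval Φ F := by
    rw [Polynomial.X_pow_dvd_iff] at s1 ⊢
    intro n hn
    cases n with
    | zero => rw [coeff0_aeval, hΦR', hR]
    | succ n =>
      have := s1 n (by omega)
      rw [Polynomial.coeff_derivative] at this
      exact (mul_eq_zero.mp this).resolve_right (by exact_mod_cast Nat.succ_ne_zero n)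
  have s2 : ∀ i, Polynomial.X ^ k ∣ aeval Φ (pderiv i F) := by
    intro i
    by_cases h : i = r
    · subst h
      have he := euler_aeval hFh Φ
      rw [← Finset.add_sum_erase _ _ (Finset.mem_univ i), hΦr, one_mul] at he
      rw [← eq_sub_iff_add_eq] at he
      rw [he]
      refine dvd_sub (((pow_dvd_pow _ (by omega)).trans s1').mul_left _)
        (Finset.dvd_sum fun j hj => (hdiv j (Finset.ne_of_mem_erase hj)).mul_left _)
    · exact hdiv i h
  set B : Fin 4 → K := fun i => (Φ i).coeff 1 with hB
  have hWB : ∀ i, ∑ j, eval R (pderiv j (pderiv i F)) * B j = 0 := by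
    intro i
    have := Polynomial.X_pow_dvd_iff.mp (s2 i) 1 (by omega)
    rwa [coeff1_aeval, hΦR'] at this
  have hWR : ∀ i, ∑ j, eval R (pderiv j (pderiv i F)) * R j = 0 := by
    intro i
    have := euler_eval (hFh.pderiv (i := i)) R
    rw [hRi, mul_zero] at this
    simpa only [mul_comm] using this
  -- step 4
  set φ := Φ ∘ Fin.succ with hφ
  set a := R ∘ Fin.succ with hadef
  have hφa : (fun i => (φ i).coeff 0) = a := funext fun i => hΦR _
  have hfφ : Polynomial.X ^ k ∣ aeval φ f := by
    have := s2 0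
    rwa [hF, monF_d0, aeval_rename] at this
  set G : MvPolynomial (Fin 3) K := C (R 0) * f + g with hG
  have hGφ : Polynomial.X ^ (k + 1) ∣ aeval φ G := by
    have h1 : aeval φ G = aeval Φ F - (Φ 0 - Polynomial.C (R 0)) * aeval φ f := by
      rw [hF, aeval_monF, hG, map_add, map_mul, algHom_C, Polynomial.algebraMap_eq]
      ring
    rw [h1]
    refine dvd_sub s1' ?_
    rw [pow_succ']
    refine mul_dvd_mul (Polynomial.X_dvd_iff.mpr ?_) hfφ
    simp [hΦR]
  have hGa : ∀ i, eval a (pderiv i G) = 0 := by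
    intro i
    have := hRi i.succ
    rw [hF, monF_ds, eval_monF] at this
    simpa [hG] using this
  -- step 5
  obtain ⟨u, hu⟩ := hfφ
  set c : K := -(u.coeff 0) / eval a (pderiv i0 f) with hc
  set y : Fin 3 → Polynomial K := Pi.single i0 (Polynomial.X ^ k * Polynomial.C c) with hy
  have hyJ : ∀ j, y j ∈ Ideal.span {(Polynomial.X ^ k : Polynomial K)} := by
    intro j
    rw [Ideal.mem_span_singleton, hy]
    by_cases h : j = i0
    · subst h; simp
    · simp [h]
  have htay : ∀ p : MvPolynomial (Fin 3) K, Polynomial.X ^ (k + 1) ∣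
      aeval (φ + y) p - (aeval φ p + Polynomial.X ^ k * Polynomial.C c * aeval φ (pderiv i0 p)) := by
    intro p
    have h := taylor _ φ y hyJ p
    rw [Ideal.span_singleton_pow, Ideal.mem_span_singleton, ← pow_mul] at h
    have hs : ∑ j, y j * aeval φ (pderiv j p)
        = Polynomial.X ^ k * Polynomial.C c * aeval φ (pderiv i0 p) := by
      rw [Finset.sum_eq_single i0]
      · simp [hy]
      · intro b _ hb; simp [hy, hb]
      · simp
    rw [hs] at h
    exact (pow_dvd_pow _ (by omega)).trans h
  have hfin : Polynomial.X ^ (k + 1) ∣ aeval (φ + y) f := by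
    have h := htay f
    rw [dvd_sub_left] at h
    · exact h
    rw [hu, mul_assoc, ← mul_add, pow_succ]
    refine mul_dvd_mul_left _ (Polynomial.X_dvd_iff.mpr ?_)
    rw [Polynomial.coeff_add, Polynomial.coeff_C_mul, coeff0_aeval, hφa, hc]
    field_simp
    ring
  have hGin : Polynomial.X ^ (k + 1) ∣ aeval (φ + y) G := by
    have h := htay G
    rw [dvd_sub_left] at h
    · exact h
    refine dvd_add hGφ ?_
    rw [mul_assoc, pow_succ]
    refine mul_dvd_mul_left _ (Polynomial.X_dvd_iff.mpr ?_)
    rw [Polynomial.coeff_C_mul, coeff0_aeval, hφa, hGa, mul_zero]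
  have hgin : Polynomial.X ^ (k + 1) ∣ aeval (φ + y) g := by
    have : aeval (φ + y) g = aeval (φ + y) G - Polynomial.C (R 0) * aeval (φ + y) f := by
      rw [hG, map_add, map_mul, algHom_C, Polynomial.algebraMap_eq]
      ring
    rw [this]
    exact dvd_sub hGin (hfin.mul_left _)
  -- step 6
  have hy01 : ∀ j, ∀ n < 2, (y j).coeff n = 0 := by
    intro j n hn
    exact Polynomial.X_pow_dvd_iff.mp (Ideal.mem_span_singleton.mp (hyJ j)) n (by omega)
  have e0 : ∀ j, ((φ + y) j).coeff 0 = a j := by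
    intro j
    rw [Pi.add_apply, Polynomial.coeff_add, hy01 j 0 (by omega), add_zero]
    exact hΦR _
  have e1 : ∀ j, ((φ + y) j).coeff 1 = B j.succ := by
    intro j
    rw [Pi.add_apply, Polynomial.coeff_add, hy01 j 1 (by omega), add_zero]
    rfl
  obtain ⟨i1, hi1⟩ : ∃ i, a i ≠ 0 := Function.ne_iff.mp ha
  obtain ⟨i2, hi2⟩ : ∃ i2, a i1 * B i2.succ - a i2 * B i1.succ ≠ 0 := by
    by_contra! h
    set t := B i1.succ / a i1 with ht
    have hz : (fun i => B i - t * R i) = 0 := by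
      refine ker_hess (g := g) hi0 _ ?_ ?_
      · intro i
        rw [← hF]
        simp only [mul_sub, Finset.sum_sub_distrib]
        rw [hWB, zero_sub, neg_eq_zero]
        have := congrArg (fun z => t * z) (hWR i)
        simp only [Finset.mul_sum, mul_zero] at this
        rw [← this]
        exact Finset.sum_congr rfl fun j _ => by ring
      · intro j
        have h1 := h j
        have : R j.succ = a j := rfl
        rw [this, ht]
        field_simp
        linear_combination h1
    have hr := congrFun hz r
    have hBr : B r = 0 := by
      rw [hB]; simp [hΦr, Polynomial.coeff_one]
    simp only [hBr, hRr, mul_one, zero_sub, Pi.zero_apply, neg_eq_zero] at hr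
    obtain ⟨i, hi⟩ := hΦ1
    apply hi
    have := congrFun hz i
    simpa [hr] using this
  refine bezout_curve hf hg hg0 hrel (φ + y) (X i1) (C (a i1) * X i2 - C (a i2) * X i1)
    (isHomogeneous_X _ _) ((isHomogeneous_C_mul_X _ _).sub (isHomogeneous_C_mul_X _ _)) ?_ ?_ ?_
    hfin hgin
  · rw [aeval_X, e0]; exact hi1
  · simp only [map_sub, map_mul, aeval_X, algHom_C, Polynomial.algebraMap_eq, Polynomial.coeff_sub,
      Polynomial.coeff_C_mul, e0]
    ring
  · simp only [map_sub, map_mul, aeval_X, algHom_C, Polynomial.algebraMap_eq, Polynomial.coeff_sub,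
      Polynomial.coeff_C_mul, e1]
    exact hi2

lemma rank_hess {f g : MvPolynomial (Fin 3) K} {d : ℕ} (hd : 3 ≤ d)
    (hf : f.IsHomogeneous (d - 1)) (hg : g.IsHomogeneous d) (R : Fin 4 → K) (i0 : Fin 3)
    (hi0 : eval (R ∘ Fin.succ) (pderiv i0 f) ≠ 0)
    (hRi : ∀ i, eval R (pderiv i (monF f g)) = 0)
    (r : Fin 4) (hRr : R r = 1) (Q : Matrix (Fin 3) (Fin 3) K)
    (hQ : ∀ i j, Q i j =
      eval R (pderiv (r.succAbove j) (pderiv (r.succAbove i) (monF f g)))) : 2 ≤ Q.rank := by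
  have hFh := monF_hom (by omega) hf hg
  set F := monF f g with hF
  have hWR : ∀ i, ∑ j, eval R (pderiv j (pderiv i F)) * R j = 0 := by
    intro i
    have := euler_eval (hFh.pderiv (i := i)) R
    rw [hRi, mul_zero] at this
    simpa only [mul_comm] using this
  let ins : (Fin 3 → K) →ₗ[K] (Fin 4 → K) :=
    { toFun := fun c => r.insertNth (0 : K) c
      map_add' := by
        intro x y
        ext i
        refine Fin.succAboveCases r ?_ (fun j => ?_) i <;> simp
      map_smul' := by
        intro t x
        ext i
        refine Fin.succAboveCases r ?_ (fun j => ?_) i <;> simp }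
  have insr : ∀ c, ins c r = 0 := fun c => by simp [ins]
  have inss : ∀ c j, ins c (r.succAbove j) = c j := fun c j => by simp [ins]
  have hker : ∀ c, Q.mulVec c = 0 → ∀ i, ∑ j, eval R (pderiv j (pderiv i F)) * ins c j = 0 := by
    intro c hc
    have h1 : ∀ i : Fin 3,
        ∑ j, eval R (pderiv j (pderiv (r.succAbove i) F)) * ins c j = 0 := by
      intro i
      rw [Fin.sum_univ_succAbove _ r, insr, mul_zero, zero_add]
      have := congrFun hc i
      simp only [Matrix.mulVec, dotProduct, Pi.zero_apply, hQ] at this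
      simpa only [inss] using this
    intro i
    refine Fin.succAboveCases r ?_ (fun j => h1 j) i
    have h2 : ∑ i, R i * ∑ j, eval R (pderiv j (pderiv i F)) * ins c j = 0 := by
      simp only [Finset.mul_sum]
      rw [Finset.sum_comm]
      refine Finset.sum_eq_zero fun j _ => ?_
      have := congrArg (fun z => z * ins c j) (hWR j)
      simp only [Finset.sum_mul, zero_mul] at this
      rw [← this]
      refine Finset.sum_congr rfl fun i _ => ?_
      rw [pd_comm j i]
      ring
    have h3 : ∑ i : Fin 3, R (r.succAbove i) *
        ∑ j, eval R (pderiv j (pderiv (r.succAbove i) F)) * ins c j = 0 :=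
      Finset.sum_eq_zero (fun i _ => by rw [h1, mul_zero])
    rw [Fin.sum_univ_succAbove _ r, hRr, one_mul, h3, add_zero] at h2
    exact h2
  let N := LinearMap.ker Q.mulVecLin
  let res : (Fin 4 → K) →ₗ[K] (Fin 3 → K) := LinearMap.funLeft K K Fin.succ
  let L : (N × K) →ₗ[K] (Fin 3 → K) :=
    res ∘ₗ ((ins ∘ₗ N.subtype).coprod (LinearMap.toSpanSingleton K (Fin 4 → K) R))
  have hLv : ∀ c : N, ∀ t : K, L (c, t) = res (ins c + t • R) := fun c t => by simp [L]
  have hW : ∀ c : N, ∀ t : K, ∀ i,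
      ∑ j, eval R (pderiv j (pderiv i F)) * (ins c + t • R) j = 0 := by
    intro c t i
    have h1 := hker c.1 (LinearMap.mem_ker.mp c.2) i
    have h2 := hWR i
    simp only [Pi.add_apply, Pi.smul_apply, smul_eq_mul, mul_add, Finset.sum_add_distrib]
    rw [h1, zero_add]
    have := congrArg (fun z => t * z) h2
    simp only [Finset.mul_sum, mul_zero] at this
    rw [← this]
    exact Finset.sum_congr rfl fun j _ => by ring
  have hinj : Function.Injective L := by
    rw [injective_iff_map_eq_zero]
    rintro ⟨c, t⟩ h
    rw [hLv] at h
    have hz := ker_hess (g := g) hi0 _ (hW c t) (fun j => congrFun h j)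
    have ht : t = 0 := by
      have := congrFun hz r
      simpa [insr, hRr] using this
    have hc : c = 0 := by
      ext j
      have := congrFun hz (r.succAbove j)
      simpa [inss, ht] using this
    rw [ht, hc]; rfl
  have hne : LinearMap.range L ≠ ⊤ := by
    intro htop
    obtain ⟨⟨c, t⟩, h⟩ : Pi.single i0 1 ∈ LinearMap.range L := htop ▸ Submodule.mem_top
    rw [hLv] at h
    have h0 := hW c t 0
    have hs : ∀ j : Fin 3, (ins c + t • R) j.succ = (Pi.single i0 1 : Fin 3 → K) j :=
      fun j => congrFun h j
    rw [Fin.sum_univ_succ, hF, monF_d0, pderiv_zero_ren, map_zero, zero_mul, zero_add] at h0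
    simp only [hs, pderiv_rename (Fin.succ_injective 3), eval_rename] at h0
    rw [Finset.sum_eq_single i0] at h0
    · simp only [Pi.single_eq_same, mul_one] at h0
      exact hi0 h0
    · intro b _ hb; simp [hb]
    · simp
  have r1 := Submodule.finrank_lt hne
  rw [LinearMap.finrank_range_of_inj hinj, Module.finrank_prod, Module.finrank_self,
    Module.finrank_fin_fun] at r1
  have r2 := LinearMap.finrank_range_add_finrank_ker Q.mulVecLin
  rw [Module.finrank_fin_fun] at r2
  change 2 ≤ Module.finrank K (LinearMap.range Q.mulVecLin)
  change Module.finrank K (LinearMap.ker Q.mulVecLin) + 1 < 3 at r1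
  omega

lemma eval_smul_hom {n e : ℕ} {p : MvPolynomial (Fin n) K} (hp : p.IsHomogeneous e)
    (t : K) (P : Fin n → K) : eval (t • P) p = t ^ e * eval P p := by
  rw [eval_eq, eval_eq, Finset.mul_sum]
  refine Finset.sum_congr rfl fun m hm => ?_
  have hdeg := hp.degree_eq_sum_deg_support hm
  simp only [Pi.smul_apply, smul_eq_mul, mul_pow, Finset.prod_mul_distrib, Finset.prod_pow_eq_pow_sum]
  rw [hdeg]
  ring

/-- the Milnor number of any singular point other than `O = (1:0:0:0)` on a
normalized non-degenerate monoid surface of degree `d` is at most `d(d-1) - 1`. -/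
theorem stmt10 [CharZero K] [IsAlgClosed K] {d : ℕ} (hd : 3 ≤ d)
    (f g : MvPolynomial (Fin 3) K)
    (hf : f.IsHomogeneous (d - 1)) (hg : g.IsHomogeneous d) (hf0 : f ≠ 0) (hg0 : g ≠ 0)
    (hgcd : ∀ q : MvPolynomial (Fin 3) K, q ∣ f → q ∣ g → IsUnit q)
    (hnocsing : ∀ b : Fin 3 → K, b ≠ 0 →
      ¬((eval b f = 0 ∧ ∀ j, eval b (pderiv j f) = 0) ∧
        (eval b g = 0 ∧ ∀ j, eval b (pderiv j g) = 0)))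
    (P : Fin 4 → K) (hPO : (P ∘ Fin.succ) ≠ 0)
    (hsing : SingularAt (X 0 * rename Fin.succ f + rename Fin.succ g) P) :
    ∀ r : Fin 4, P r ≠ 0 →
      milnorNumber (localEq (X 0 * rename Fin.succ f + rename Fin.succ g) P r) ≤
        d * (d - 1) - 1 := by
  intro r hPr
  change SingularAt (monF f g) P at hsing
  change milnorNumber (localEq (monF f g) P r) ≤ _
  have hFh := monF_hom (by omega) hf hg
  obtain ⟨hs0, hs1⟩ := hsing
  set R : Fin 4 → K := (P r)⁻¹ • P with hRdef
  have hRr : R r = 1 := by simp [hRdef, hPr]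
  have hR : eval R (monF f g) = 0 := by rw [hRdef, eval_smul_hom hFh, hs0, mul_zero]
  have hRi : ∀ i, eval R (pderiv i (monF f g)) = 0 := fun i => by
    rw [hRdef, eval_smul_hom (hFh.pderiv), hs1, mul_zero]
  have ha : R ∘ Fin.succ ≠ 0 := by
    intro h
    apply hPO
    ext j
    have := congrFun h j
    simpa [hRdef, hPr] using this
  obtain ⟨i0, hi0⟩ : ∃ i0, eval (R ∘ Fin.succ) (pderiv i0 f) ≠ 0 := by
    by_contra! h
    have hf' : eval (R ∘ Fin.succ) f = 0 := by
      have := hRi 0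
      rwa [monF_d0, eval_rename] at this
    refine hnocsing _ ha ⟨⟨hf', h⟩, ?_, fun j => ?_⟩
    · rw [eval_monF, hf'] at hR; simpa using hR
    · have := hRi j.succ
      rw [monF_ds, eval_monF, h] at this
      simpa using this
  set H := localEq (monF f g) P r with hH
  let Θ : Fin 4 → MvPolynomial (Fin 3) K :=
    r.succAboveCases (1 : MvPolynomial (Fin 3) K) (fun j => C (P (r.succAbove j) / P r) + X j)
  have hΘr : Θ r = 1 := by simp [Θ]
  have hΘs : ∀ j, Θ (r.succAbove j) = C (R (r.succAbove j)) + X j := by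
    intro j
    simp [Θ, hRdef, div_eq_inv_mul]
  have hpd : ∀ (G : MvPolynomial (Fin 4) K) (i : Fin 3),
      pderiv i (aeval Θ G) = aeval Θ (pderiv (r.succAbove i) G) := by
    intro G i
    rw [chainD (pderiv i) Θ G, Fin.sum_univ_succAbove _ r, hΘr, Derivation.map_one_eq_zero,
      mul_zero, zero_add, Finset.sum_eq_single i]
    · simp [hΘs]
    · intro b _ hb
      rw [hΘs, map_add, pderiv_C, pderiv_X_of_ne hb]; simp
    · simp
  have hev : ∀ G : MvPolynomial (Fin 4) K, eval 0 (aeval Θ G) = eval R G := by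
    intro G
    have : (eval (0 : Fin 3 → K)).comp (aeval Θ : _ →ₐ[K] MvPolynomial (Fin 3) K).toRingHom
        = eval R := by
      apply MvPolynomial.ringHom_ext
      · intro c; simp
      · intro i
        refine Fin.succAboveCases r ?_ (fun j => ?_) i
        · simp [hΘr, hRr]
        · simp [hΘs]
    exact congrArg (fun h => h G) this
  have hHi : ∀ i, pderiv i H = aeval Θ (pderiv (r.succAbove i) (monF f g)) := fun i => hpd _ i
  let Q : Matrix (Fin 3) (Fin 3) K := Matrix.of fun i j => eval 0 (pderiv j (pderiv i H))
  have hQ2 : 2 ≤ Q.rank := by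
    refine rank_hess hd hf hg R i0 hi0 hRi r hRr Q (fun i j => ?_)
    simp only [Q, Matrix.of_apply]
    rw [hHi, hpd, hev]
  have hsix : 6 ≤ d * (d - 1) := by
    calc 6 = 3 * 2 := rfl
      _ ≤ d * (d - 1) := Nat.mul_le_mul hd (by omega)
  by_cases hk : 2 ≤ milnorNumber H
  · obtain ⟨φ, hφ0, ⟨i1, hφ1⟩, hφd⟩ := local_curve H (fun i => by rw [hHi, hev, hRi]) Q
      (fun i j => rfl) hQ2 hk
    let Φ : Fin 4 → Polynomial K := fun i => aeval φ (Θ i)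
    have hΦr : Φ r = 1 := by simp [Φ, hΘr]
    have hΦs : ∀ j, Φ (r.succAbove j) = Polynomial.C (R (r.succAbove j)) + φ j := by
      intro j
      simp [Φ, hΘs, Polynomial.algebraMap_eq]
    have hcomp : ∀ G : MvPolynomial (Fin 4) K, aeval φ (aeval Θ G) = aeval Φ G := fun G =>
      MvPolynomial.comp_aeval_apply Θ (aeval φ) G
    have := core hd hk f g hf hg hg0 (fun q h1 h2 => hgcd q h1 h2) R ha i0 hi0 hR hRi r hRr Φ hΦr
      (by
        intro i
        refine Fin.succAboveCases r ?_ (fun j => ?_) i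
        · simp [hΦr, hRr]
        · simp [hΦs, hφ0])
      ⟨r.succAbove i1, by simpa [hΦs, Polynomial.coeff_C] using hφ1⟩
      (by
        intro i hi
        obtain ⟨j, rfl⟩ := Fin.exists_succAbove_eq hi
        rw [← hcomp, ← hHi]
        exact hφd j)
    rw [mul_comm] at this
    omega
  · omega
end

section
/- For d ≥ 3, the surface X = Z(x₀(x₁x₂^{d−2} + x₃^{d−1}) + x₁^d) ⊂ ℙ³ has the point (0:0:1:0) as a singular point, and the local intersection multiplicity at (0:1:0) of the tangent cone f_{d-1} = x₁x₂^{d−2} + x₃^{d−1} with f_d = x₁^d equals d(d−1); hence (0:0:1:0) is an A_{d(d−1)−1} singularity, achieving the maximal Milnor number d(d−1) − 1 for a singularity other than O. -/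
open MvPolynomial

variable {K : Type*} [Field K]

noncomputable def lineEval (p : Fin 3 → K) :
    MvPolynomial (Fin 3) K →ₐ[K] Polynomial K :=
  aeval fun i => Polynomial.C (p i) * Polynomial.X

noncomputable def lineCompl (p : Fin 3 → K) : Submonoid (MvPolynomial (Fin 3) K) where
  carrier := {h | lineEval p h ≠ 0}
  one_mem' := by simp [lineEval]
  mul_mem' := by
    intro a b ha hb
    simp only [Set.mem_setOf_eq, map_mul] at *
    exact mul_ne_zero ha hb

noncomputable def interMult (f g : MvPolynomial (Fin 3) K) (p : Fin 3 → K) : WithBot ℕ∞ :=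
  Order.krullDim (Ideal (Localization (lineCompl p) ⧸
    (Ideal.span {algebraMap (MvPolynomial (Fin 3) K) (Localization (lineCompl p)) f,
      algebraMap (MvPolynomial (Fin 3) K) (Localization (lineCompl p)) g})))

def IsATypeSing (g : MvPolynomial (Fin 3) K) (n : ℕ) : Prop :=
  ∃ e : MvPowerSeries (Fin 3) K ≃ₐ[K] MvPowerSeries (Fin 3) K,
    e (g : MvPowerSeries (Fin 3) K) =
      (MvPowerSeries.X 0) ^ 2 + (MvPowerSeries.X 1) ^ 2 + (MvPowerSeries.X 2) ^ (n + 1)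

lemma chainDim {R : Type*} [CommRing R] (p : R) (N : ℕ) (hN : 0 < N) (h0 : p ^ N = 0)
    (h1 : p ^ (N - 1) ≠ 0) (hu : ∀ r : R, IsUnit r ∨ p ∣ r) :
    Order.krullDim (Ideal R) = ((N : ℕ) : ℕ∞) := by
  have key : ∀ a b, b < a → b < N → ¬ p ^ a ∣ p ^ b := by
    rintro a b hab hb ⟨c, hc⟩
    have hnil : IsNilpotent (p ^ (a - b) * c) := by
      refine ⟨N, ?_⟩
      rw [mul_pow, ← pow_mul, mul_comm (a - b), pow_mul, h0, zero_pow (by omega), zero_mul]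
    have hun := hnil.isUnit_one_sub
    have : p ^ b * (1 - p ^ (a - b) * c) = 0 := by
      have e : p ^ a = p ^ b * p ^ (a - b) := by rw [← pow_add]; congr 1; omega
      rw [mul_sub, ← mul_assoc, ← e, ← hc]; ring
    have hb0 : p ^ b = 0 := (hun.mul_left_eq_zero).1 this
    apply h1
    have : N - 1 = b + (N - 1 - b) := by omega
    rw [this, pow_add, hb0, zero_mul]
  have dec : ∀ r : R, ∀ k, p ^ k ∣ r ∨ ∃ j < k, ∃ u : R, IsUnit u ∧ r = p ^ j * u := by
    intro r k
    induction k with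
    | zero => left; simp
    | succ k ih =>
      rcases ih with ⟨s, hs⟩ | ⟨j, hj, u, hu', e⟩
      · rcases hu s with h | ⟨t, ht⟩
        · exact Or.inr ⟨k, by omega, s, h, hs⟩
        · left; exact ⟨t, by rw [hs, ht]; ring⟩
      · exact Or.inr ⟨j, by omega, u, hu', e⟩
  let F : Fin (N + 1) → Ideal R := fun i => Ideal.span {p ^ (N - i.1)}
  have hF : StrictMono F := by
    intro i j hij
    have hij' : i.1 < j.1 := hij
    have := j.2
    refine lt_of_le_not_ge ?_ ?_
    · exact Ideal.span_singleton_le_span_singleton.2 (pow_dvd_pow _ (by omega))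
    · intro h
      exact key _ _ (by omega) (by omega) (Ideal.span_singleton_le_span_singleton.1 h)
  have hs : Function.Surjective F := by
    classical
    intro J
    have hex : ∃ i, p ^ i ∈ J := ⟨N, by rw [h0]; exact J.zero_mem⟩
    have hi := Nat.find_spec hex
    have hle : Nat.find hex ≤ N := Nat.find_min' hex (by rw [h0]; exact J.zero_mem)
    refine ⟨⟨N - Nat.find hex, by omega⟩, ?_⟩
    have e : N - (N - Nat.find hex) = Nat.find hex := by omega
    simp only [F, e]
    apply le_antisymm
    · rw [Ideal.span_singleton_le_iff_mem]; exact hi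
    · intro r hr
      rw [Ideal.mem_span_singleton]
      rcases dec r (Nat.find hex) with h | ⟨j, hj, u, hu', e⟩
      · exact h
      · exfalso
        apply Nat.find_min hex hj
        rw [e] at hr
        exact (Ideal.mul_unit_mem_iff_mem J hu').1 hr
  rw [← Order.krullDim_eq_of_orderIso (hF.orderIsoOfSurjective F hs)]
  apply le_antisymm
  · apply iSup_le
    intro s
    have := s.length_lt_card
    rw [Fintype.card_fin] at this
    exact_mod_cast Nat.le_of_lt_succ this
  · exact le_iSup (fun s : LTSeries (Fin (N + 1)) => ((s.length : ℕ) : WithBot ℕ∞))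
      ⟨N, fun i => i, fun i => Fin.castSucc_lt_succ⟩

lemma finrankQuot {K A : Type*} [Field K] [CommRing A] [Algebra K A] (I : Ideal A) (N : ℕ)
    (L : A →ₗ[K] (Fin N → K)) (hs : Function.Surjective L) (hk : ∀ x, L x = 0 ↔ x ∈ I) :
    Module.finrank K (A ⧸ I) = N := by
  have e : I.restrictScalars K = LinearMap.ker L := by
    ext x; simp [hk]
  have e1 := (Submodule.Quotient.restrictScalarsEquiv K I).symm
  have e2 := Submodule.quotEquivOfEq _ _ e
  have e3 := L.quotKerEquivOfSurjective hs
  rw [((e1.trans e2).trans e3).finrank_eq]; simp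

open MvPowerSeries in
lemma mkAut {K : Type*} [Field K] (a b : Fin 3 → MvPowerSeries (Fin 3) K)
    (ha : ∀ s, constantCoeff (a s) = 0) (hb : ∀ s, constantCoeff (b s) = 0)
    (hab : ∀ φ : MvPowerSeries (Fin 3) K →ₐ[K] MvPowerSeries (Fin 3) K,
      (∀ s, φ (MvPowerSeries.X s) = a s) → ∀ s, φ (b s) = MvPowerSeries.X s)
    (hba : ∀ φ : MvPowerSeries (Fin 3) K →ₐ[K] MvPowerSeries (Fin 3) K,
      (∀ s, φ (MvPowerSeries.X s) = b s) → ∀ s, φ (a s) = MvPowerSeries.X s) :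
    ∃ e : MvPowerSeries (Fin 3) K ≃ₐ[K] MvPowerSeries (Fin 3) K, ∀ s, e (MvPowerSeries.X s) = a s := by
  have Ha : HasSubst a := hasSubst_of_constantCoeff_zero ha
  have Hb : HasSubst b := hasSubst_of_constantCoeff_zero hb
  have h1 := hab (substAlgHom Ha) (fun s => substAlgHom_X Ha s)
  have h2 := hba (substAlgHom Hb) (fun s => substAlgHom_X Hb s)
  refine ⟨AlgEquiv.ofAlgHom (substAlgHom Ha) (substAlgHom Hb) ?_ ?_, ?_⟩
  · ext1 f
    simp only [AlgHom.comp_apply, coe_substAlgHom] at h1 ⊢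
    rw [subst_comp_subst_apply Hb Ha]
    simp only [h1]
    simp [subst_self]
  · ext1 f
    simp only [AlgHom.comp_apply, coe_substAlgHom] at h2 ⊢
    rw [subst_comp_subst_apply Ha Hb]
    simp only [h2]
    simp [subst_self]
  · intro s
    exact substAlgHom_X Ha s

open MvPowerSeries in
lemma monoKer {K : Type*} [Field K] (N : ℕ) (f : MvPowerSeries (Fin 3) K) :
    (∀ i : Fin N, coeff (Finsupp.single 2 i.1) f = 0) ↔
      f ∈ Ideal.span {(MvPowerSeries.X 0 : MvPowerSeries (Fin 3) K), MvPowerSeries.X 1, MvPowerSeries.X 2 ^ N} := by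
  classical
  constructor
  · intro h
    let f0 : MvPowerSeries (Fin 3) K := fun m => if m 0 = 0 then 0 else f m
    let f1 : MvPowerSeries (Fin 3) K := fun m => if m 0 = 0 then (if m 1 = 0 then 0 else f m) else 0
    let f2 : MvPowerSeries (Fin 3) K := fun m => if m 0 = 0 then (if m 1 = 0 then f m else 0) else 0
    have e : f = f0 + f1 + f2 := by
      funext m
      change f m = f0 m + f1 m + f2 m
      simp only [f0, f1, f2]
      split_ifs <;> simp
    have d0 : MvPowerSeries.X 0 ∣ f0 := by
      rw [X_dvd_iff]; intro m hm
      change f0 m = 0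
      simp [f0, hm]
    have d1 : MvPowerSeries.X 1 ∣ f1 := by
      rw [X_dvd_iff]; intro m hm
      change f1 m = 0
      simp [f1, hm]
    have d2 : MvPowerSeries.X 2 ^ N ∣ f2 := by
      rw [X_pow_dvd_iff]; intro m hm
      change f2 m = 0
      simp only [f2]
      split_ifs with h0 h1
      · have : m = Finsupp.single 2 (m 2) := by
          ext s; fin_cases s <;> simp [h0, h1]
        rw [this]
        exact h ⟨m 2, hm⟩
      · rfl
      · rfl
    rw [e]
    refine Ideal.add_mem _ (Ideal.add_mem _ ?_ ?_) ?_
    · exact Ideal.mem_of_dvd _ d0 (Ideal.subset_span (by simp))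
    · exact Ideal.mem_of_dvd _ d1 (Ideal.subset_span (by simp))
    · exact Ideal.mem_of_dvd _ d2 (Ideal.subset_span (by simp))
  · intro h i
    rw [Ideal.mem_span_insert] at h
    obtain ⟨a, z, hz, rfl⟩ := h
    rw [Ideal.mem_span_pair] at hz
    obtain ⟨b, c, rfl⟩ := hz
    have h0 := X_dvd_iff.1 (Dvd.intro_left a rfl : (MvPowerSeries.X 0 : MvPowerSeries (Fin 3) K) ∣ a * MvPowerSeries.X 0)
      (Finsupp.single 2 i.1) (by simp)
    have h1 := X_dvd_iff.1 (Dvd.intro_left b rfl : (MvPowerSeries.X 1 : MvPowerSeries (Fin 3) K) ∣ b * MvPowerSeries.X 1)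
      (Finsupp.single 2 i.1) (by simp)
    have h2 := X_pow_dvd_iff.1
      (Dvd.intro_left c rfl : (MvPowerSeries.X 2 : MvPowerSeries (Fin 3) K) ^ N ∣ c * MvPowerSeries.X 2 ^ N)
      (Finsupp.single 2 i.1) (by simp)
    rw [map_add, map_add, h0, h1, h2]; simp

lemma monoSurj {K : Type*} [Field K] (N : ℕ) (v : Fin N → K) :
    ∃ f : MvPowerSeries (Fin 3) K, ∀ i : Fin N,
      MvPowerSeries.coeff (Finsupp.single 2 i.1) f = v i := by
  refine ⟨fun m => if h : m 2 < N then v ⟨m 2, h⟩ else 0, fun i => ?_⟩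
  change (if h : (Finsupp.single (2 : Fin 3) i.1) 2 < N then v ⟨_, h⟩ else 0) = _
  simp

lemma localEq_eq (d : ℕ) : localEq (X 0 * rename Fin.succ (X 0 * X 1 ^ (d - 2) + X 2 ^ (d - 1) : MvPolynomial (Fin 3) K) +
            rename Fin.succ (X 0 ^ d : MvPolynomial (Fin 3) K))
          (fun i => if i = 2 then 1 else 0) 2 = X 0 * (X 1 + X 2 ^ (d-1)) + X 1 ^ d := by
  have h0 : ∀ (v : Fin 3 → MvPolynomial (Fin 3) K), (Fin.succAboveCases (α := fun _ => MvPolynomial (Fin 3) K) (2 : Fin 4) 1 v) 0 = v 0 := fun v =>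
    rfl
  have h1 : ∀ (v : Fin 3 → MvPolynomial (Fin 3) K), (Fin.succAboveCases (α := fun _ => MvPolynomial (Fin 3) K) (2 : Fin 4) 1 v) 1 = v 1 := fun v =>
    rfl
  have h3 : ∀ (v : Fin 3 → MvPolynomial (Fin 3) K), (Fin.succAboveCases (α := fun _ => MvPolynomial (Fin 3) K) (2 : Fin 4) 1 v) 3 = v 2 := fun v =>
    rfl
  have h2 : ∀ (v : Fin 3 → MvPolynomial (Fin 3) K), (Fin.succAboveCases (α := fun _ => MvPolynomial (Fin 3) K) (2 : Fin 4) 1 v) 2 = 1 := fun v =>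
    rfl
  have s0 : (0 : Fin 3).succ = 1 := rfl
  have s1 : (1 : Fin 3).succ = 2 := rfl
  have s2 : (2 : Fin 3).succ = 3 := rfl
  have t0 : (2 : Fin 4).succAbove 0 = 0 := rfl
  have t1 : (2 : Fin 4).succAbove 1 = 1 := rfl
  have t2 : (2 : Fin 4).succAbove 2 = 3 := rfl
  simp only [localEq, map_add, map_mul, map_pow, rename_X, aeval_X, s0, s1, s2, h0, h1, h2, h3, t0, t1, t2]
  simp

lemma sing_part {d : ℕ} (hd : 3 ≤ d) :
    SingularAt
        (X 0 * rename Fin.succ (X 0 * X 1 ^ (d - 2) + X 2 ^ (d - 1) : MvPolynomial (Fin 3) K) +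
          rename Fin.succ (X 0 ^ d : MvPolynomial (Fin 3) K))
        (fun i => if i = 2 then 1 else 0) := by
  have s0 : (0 : Fin 3).succ = 1 := rfl
  have s1 : (1 : Fin 3).succ = 2 := rfl
  have s2 : (2 : Fin 3).succ = 3 := rfl
  have e1 : d - 1 ≠ 0 := by omega
  have e2 : d - 2 ≠ 0 := by omega
  have e4 : d - 1 - 1 ≠ 0 := by omega
  have e3 : d ≠ 0 := by omega
  constructor
  · simp [s0, s1, s2, e1, e3]
  · intro i
    simp only [map_add, map_mul, map_pow, rename_X, s0, s1, s2, Derivation.leibniz,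
      Derivation.leibniz_pow, pderiv_X, smul_eq_mul, nsmul_eq_mul, eval_X, map_natCast]
    fin_cases i <;> simp [e1, e2, e3, e4]

lemma lineEval_mem (h : MvPolynomial (Fin 3) K)
    (hh : lineEval (fun j : Fin 3 => if j = 1 then (1 : K) else 0) h = 0) :
    h ∈ Ideal.span {(X 0 : MvPolynomial (Fin 3) K), X 2} := by
  set I := Ideal.span {(X 0 : MvPolynomial (Fin 3) K), X 2}
  have key : (Ideal.Quotient.mkₐ K I) =
      (Polynomial.aeval (Ideal.Quotient.mkₐ K I (X 1))).comp
        (lineEval (fun j : Fin 3 => if j = 1 then (1 : K) else 0)) := by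
    apply MvPolynomial.algHom_ext
    intro i
    have h0 : Ideal.Quotient.mk I (X 0) = 0 :=
      Ideal.Quotient.eq_zero_iff_mem.2 (Ideal.subset_span (by simp))
    have h2 : Ideal.Quotient.mk I (X 2) = 0 :=
      Ideal.Quotient.eq_zero_iff_mem.2 (Ideal.subset_span (by simp))
    fin_cases i <;> simp [lineEval, h0, h2]
  have := DFunLike.congr_fun key h
  rw [AlgHom.comp_apply, hh, map_zero] at this
  exact Ideal.Quotient.eq_zero_iff_mem.1 this

lemma inter_aux {d : ℕ} (hd : 3 ≤ d) (P : Fin 3 → K) (hP : P = fun j => if j = 1 then 1 else 0)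
    (A : Type*) [CommRing A] [Algebra (MvPolynomial (Fin 3) K) A] [IsLocalization (lineCompl P) A]
    (α : MvPolynomial (Fin 3) K →+* A) (hα : α = algebraMap _ A)
    (I : Ideal A) (hI : I = Ideal.span {α (X 0 * X 1 ^ (d - 2) + X 2 ^ (d - 1)), α (X 0 ^ d)}) :
    Order.krullDim (Ideal (A ⧸ I)) = ((d * (d - 1) : ℕ) : ℕ∞) := by
  have hN : 0 < d * (d - 1) := Nat.mul_pos (by omega) (by omega)
  let q := Ideal.Quotient.mk I
  have hx1 : IsUnit (α (X 1)) := by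
    subst hα
    refine IsLocalization.map_units (M := lineCompl P) A ⟨X 1, ?_⟩
    change lineEval P (X 1) ≠ 0
    simp [lineEval, hP]
  obtain ⟨v, hv⟩ := hx1.exists_right_inv
  have hf : q (α (X 0)) * q (α (X 1)) ^ (d - 2) + q (α (X 2)) ^ (d - 1) = 0 := by
    have : q (α (X 0 * X 1 ^ (d - 2) + X 2 ^ (d - 1))) = 0 :=
      Ideal.Quotient.eq_zero_iff_mem.2 (hI ▸ Ideal.subset_span (by simp))
    simpa only [map_add, map_mul, map_pow] using this
  have hg : q (α (X 0)) ^ d = 0 := by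
    have : q (α (X 0 ^ d)) = 0 :=
      Ideal.Quotient.eq_zero_iff_mem.2 (hI ▸ Ideal.subset_span (by simp))
    simpa only [map_pow] using this
  have hz : q (α (X 2)) ^ (d - 1) = - (q (α (X 0)) * q (α (X 1)) ^ (d - 2)) := by
    linear_combination hf
  have hx0 : q (α (X 0)) = - q v ^ (d - 2) * q (α (X 2)) ^ (d - 1) := by
    have hv' : q (α (X 1)) ^ (d - 2) * q v ^ (d - 2) = 1 := by
      rw [← mul_pow, ← map_mul, hv, map_one, one_pow]
    rw [hz]; linear_combination (- q (α (X 0))) * hv'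
  apply chainDim (q (α (X 2))) _ hN
  · rw [mul_comm d, pow_mul, hz, neg_pow, mul_pow, hg]; ring
  · intro h0
    -- a map to power series over rational functions
    let L := RatFunc K
    let t : L := RatFunc.X
    have ht : t ≠ 0 := RatFunc.X_ne_zero
    let Φ : MvPolynomial (Fin 3) K →ₐ[K] PowerSeries L :=
      aeval ![- PowerSeries.C (t⁻¹ ^ (d - 2)) * PowerSeries.X ^ (d - 1), PowerSeries.C t,
        PowerSeries.X]
    have hΦ0 : Φ (X 0) = - PowerSeries.C (t⁻¹ ^ (d - 2)) * PowerSeries.X ^ (d - 1) := by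
      simp [Φ]
    have hΦ1 : Φ (X 1) = PowerSeries.C t := by simp [Φ]
    have hΦ2 : Φ (X 2) = PowerSeries.X := by simp [Φ]
    have hcc : ∀ h, PowerSeries.constantCoeff (Φ h) =
        algebraMap (Polynomial K) L (lineEval P h) := by
      intro h
      induction h using MvPolynomial.induction_on with
      | C a =>
        have : Φ (C a) = algebraMap K _ a := Φ.commutes a
        rw [this]
        have : lineEval P (C a) = algebraMap K _ a := (lineEval P).commutes a
        rw [this, ← IsScalarTower.algebraMap_apply]
        simp [PowerSeries.algebraMap_apply]
      | add p q hp hq => simp only [map_add, hp, hq]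
      | mul_X p n hp =>
        rw [map_mul, map_mul, map_mul, map_mul, hp]
        congr 1
        have e1 : d - 1 ≠ 0 := by omega
        fin_cases n
        · simp [hΦ0, lineEval, hP, e1]
        · simp [hΦ1, lineEval, hP, t, L, RatFunc.algebraMap_X]
        · simp [hΦ2, lineEval, hP]
    have hun : ∀ y : lineCompl P, IsUnit ((Φ : MvPolynomial (Fin 3) K →+* PowerSeries L) y) := by
      intro y
      rw [PowerSeries.isUnit_iff_constantCoeff]
      apply IsUnit.mk0
      change PowerSeries.constantCoeff (Φ y) ≠ 0
      rw [hcc]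
      have := y.2
      intro h
      apply this
      exact (map_eq_zero_iff _ (IsFractionRing.injective (Polynomial K) L)).1 h
    let Ψ : A →+* PowerSeries L := IsLocalization.lift hun
    have hΨ : ∀ h, Ψ (α h) = Φ h := fun h => hα ▸ IsLocalization.lift_eq hun h
    rw [← map_pow] at h0
    have hmem := Ideal.Quotient.eq_zero_iff_mem.1 h0
    rw [hI, Ideal.mem_span_pair] at hmem
    obtain ⟨a, b, hab⟩ := hmem
    have := congrArg Ψ hab
    simp only [map_add Ψ, map_mul Ψ, map_pow Ψ, hΨ, map_add Φ, map_mul Φ, map_pow Φ, map_add α,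
      map_mul α, map_pow α, hΦ0, hΦ1, hΦ2] at this
    have hCC : (PowerSeries.C (t⁻¹ ^ (d - 2)) * PowerSeries.C t ^ (d - 2) : PowerSeries L) = 1 := by
      rw [← map_pow, ← map_mul, ← mul_pow, inv_mul_cancel₀ ht]; simp
    have hdvd : (PowerSeries.X : PowerSeries L) ^ (d * (d - 1)) ∣ PowerSeries.X ^ (d * (d - 1) - 1) := by
      refine ⟨Ψ b * (- PowerSeries.C (t⁻¹ ^ (d - 2))) ^ d, ?_⟩
      rw [← this, mul_pow, ← pow_mul, mul_comm (d - 1) d]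
      linear_combination (- Ψ a * PowerSeries.X ^ (d - 1)) * hCC
    rw [PowerSeries.X_pow_dvd_iff] at hdvd
    have := hdvd (d * (d - 1) - 1) (by omega)
    simp [PowerSeries.coeff_X_pow] at this
  · intro r
    obtain ⟨a, rfl⟩ := Ideal.Quotient.mk_surjective r
    obtain ⟨⟨h, s⟩, hs⟩ := IsLocalization.surj (lineCompl P) a
    have hsu : IsUnit (α s) := hα ▸ IsLocalization.map_units A s
    by_cases hh : lineEval P h = 0
    · right
      obtain ⟨b, c, hbc⟩ := Ideal.mem_span_pair.1 (lineEval_mem h (hP ▸ hh))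
      obtain ⟨w, hw⟩ := hsu.exists_right_inv
      have ea : a = α h * w := by
        have hs' : a * α s = α h := hα ▸ hs
        rw [← hs', mul_assoc, hw, mul_one]
      change _ ∣ q a
      rw [ea, ← hbc, map_mul]
      apply Dvd.dvd.mul_right
      rw [map_add, map_mul, map_mul, map_add, map_mul, map_mul, hx0]
      apply dvd_add
      · exact ((dvd_pow_self _ (by omega)).mul_left _).mul_left _
      · exact Dvd.intro_left _ rfl
    · left
      have : IsUnit (α h) := hα ▸ IsLocalization.map_units (M := lineCompl P) A ⟨h, hh⟩
      rw [show α h = a * α s from hα ▸ hs.symm] at this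
      exact (isUnit_of_mul_isUnit_left this).map q

lemma inter_part {d : ℕ} (hd : 3 ≤ d) :
    interMult (X 0 * X 1 ^ (d - 2) + X 2 ^ (d - 1)) ((X 0 : MvPolynomial (Fin 3) K) ^ d)
        (fun j => if j = 1 then 1 else 0) = ((d * (d - 1) : ℕ) : ℕ∞) :=
  inter_aux hd _ rfl _ _ rfl _ rfl

lemma coe_nat_ps (n : ℕ) : (((n : MvPolynomial (Fin 3) K)) : MvPowerSeries (Fin 3) K) = n :=
  map_natCast (MvPolynomial.coeToMvPowerSeries.ringHom (σ := Fin 3) (R := K)) n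

/-- The quotient of `(y)^d - (-w)^d` by `y + w`. -/
noncomputable def qq {A : Type*} [CommRing A] (d : ℕ) (y w : A) : A :=
  ∑ i ∈ Finset.range d, y ^ i * (-w) ^ (d - 1 - i)

lemma qq_spec {A : Type*} [CommRing A] (d : ℕ) (y w : A) :
    qq d y w * (y + w) = y ^ d - (-w) ^ d := by
  have := (Commute.all y (-w)).geom_sum₂_mul d
  rw [sub_neg_eq_add] at this
  exact this

lemma qq_map {A B F : Type*} [CommRing A] [CommRing B] [FunLike F A B] [RingHomClass F A B]
    (φ : F) (d : ℕ) (y w : A) : φ (qq d y w) = qq d (φ y) (φ w) := by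
  simp [qq]

lemma qq_zero {A : Type*} [CommRing A] (d : ℕ) (hd : 2 ≤ d) : qq d (0 : A) 0 = 0 := by
  unfold qq
  apply Finset.sum_eq_zero
  intro i hi
  rw [neg_zero, ← pow_add, zero_pow]
  have := Finset.mem_range.1 hi
  omega

lemma type_part [CharZero K] [IsAlgClosed K] {d : ℕ} (hd : 3 ≤ d) :
    IsATypeSing (X 0 * (X 1 + X 2 ^ (d - 1)) + X 1 ^ d : MvPolynomial (Fin 3) K)
      (d * (d - 1) - 1) := by
  have hN : 0 < d * (d - 1) := Nat.mul_pos (by omega) (by omega)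
  obtain ⟨i, hi⟩ := IsAlgClosed.exists_pow_nat_eq (-1 : K) (n := 2) (by omega)
  obtain ⟨c, hc⟩ := IsAlgClosed.exists_pow_nat_eq ((-1) ^ d : K) hN
  have hc0 : c ≠ 0 := by
    rintro rfl
    rw [zero_pow hN.ne'] at hc
    exact pow_ne_zero d (neg_ne_zero.2 one_ne_zero) hc.symm
  let x : Fin 3 → MvPowerSeries (Fin 3) K := MvPowerSeries.X
  let κ := algebraMap K (MvPowerSeries (Fin 3) K)
  have hI : κ i ^ 2 = -1 := by rw [← map_pow, hi]; simp
  have hC : κ c * κ c⁻¹ = 1 := by rw [← map_mul, mul_inv_cancel₀ hc0, map_one]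
  have hH : κ 2⁻¹ * 2 = 1 := by
    have : (2 : MvPowerSeries (Fin 3) K) = κ 2 := (map_ofNat κ 2).symm
    rw [this, ← map_mul, inv_mul_cancel₀ two_ne_zero, map_one]
  have e1 : d - 1 ≠ 0 := by omega
  let a : Fin 3 → MvPowerSeries (Fin 3) K := ![x 0 - κ i * x 1 - qq d (x 0 + κ i * x 1 - (κ c * x 2) ^ (d - 1)) ((κ c * x 2) ^ (d - 1)),
    x 0 + κ i * x 1 - (κ c * x 2) ^ (d - 1), κ c * x 2]
  let b : Fin 3 → MvPowerSeries (Fin 3) K := ![κ 2⁻¹ * (x 1 + x 2 ^ (d - 1) + (x 0 + qq d (x 1) (x 2 ^ (d - 1)))),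
    - κ i * κ 2⁻¹ * (x 1 + x 2 ^ (d - 1) - (x 0 + qq d (x 1) (x 2 ^ (d - 1)))), κ c⁻¹ * x 2]
  have hx : ∀ s, MvPowerSeries.constantCoeff (x s) = 0 := fun s =>
    MvPowerSeries.constantCoeff_X s
  have hE : ∃ e : MvPowerSeries (Fin 3) K ≃ₐ[K] MvPowerSeries (Fin 3) K, ∀ s, e (x s) = a s := by
    apply mkAut a b
    · intro s
      fin_cases s <;> simp [a, qq_map, hx, e1, qq_zero d (by omega : 2 ≤ d)]
    · intro s
      fin_cases s <;> simp [b, qq_map, hx, e1, qq_zero d (by omega : 2 ≤ d)]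
    · intro φ hφ s
      have h0 : φ (x 0) = a 0 := hφ 0
      have h1 : φ (x 1) = a 1 := hφ 1
      have h2 : φ (x 2) = a 2 := hφ 2
      have hκ : ∀ r, φ (κ r) = κ r := φ.commutes
      change _ = x s
      fin_cases s <;> simp only [b, Matrix.cons_val, Fin.zero_eta, Fin.mk_one, Fin.reduceFinMk, map_add, map_sub, map_mul, map_neg, map_pow, qq_map, hκ, h0, h1, h2] <;>
        simp only [a, Matrix.cons_val]
      · linear_combination x 0 * hH
      · linear_combination - κ i ^ 2 * x 1 * hH - x 1 * hI
      · linear_combination x 2 * hC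
    · intro φ hφ s
      have h0 : φ (x 0) = b 0 := hφ 0
      have h1 : φ (x 1) = b 1 := hφ 1
      have h2 : φ (x 2) = b 2 := hφ 2
      have hκ : ∀ r, φ (κ r) = κ r := φ.commutes
      have hc2 : κ c * b 2 = x 2 := by
        simp only [b, Matrix.cons_val]; linear_combination x 2 * hC
      have hu : b 0 + κ i * b 1 = x 1 + x 2 ^ (d - 1) := by
        simp only [b, Matrix.cons_val]
        generalize qq d (x 1) (x 2 ^ (d - 1)) = q
        linear_combination (x 1 + x 2 ^ (d - 1)) * hH - κ 2⁻¹ * (x 1 + x 2 ^ (d - 1) - (x 0 + q)) * hI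
      have hv : b 0 - κ i * b 1 = x 0 + qq d (x 1) (x 2 ^ (d - 1)) := by
        simp only [b, Matrix.cons_val]
        generalize qq d (x 1) (x 2 ^ (d - 1)) = q
        linear_combination (x 0 + q) * hH + κ 2⁻¹ * (x 1 + x 2 ^ (d - 1) - (x 0 + q)) * hI
      change _ = x s
      fin_cases s <;> simp only [a, Matrix.cons_val, Fin.zero_eta, Fin.mk_one, Fin.reduceFinMk, map_add, map_sub, map_mul, map_neg, map_pow, qq_map, hκ, h0, h1, h2, hc2, hu, hv, add_sub_cancel_right]
  obtain ⟨e, he⟩ := hE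
  · refine ⟨e, ?_⟩
    have h0 : e (x 0) = a 0 := he 0
    have h1 : e (x 1) = a 1 := he 1
    have h2 : e (x 2) = a 2 := he 2
    have hcoe : ((X 0 * (X 1 + X 2 ^ (d - 1)) + X 1 ^ d : MvPolynomial (Fin 3) K) :
        MvPowerSeries (Fin 3) K) = x 0 * (x 1 + x 2 ^ (d - 1)) + x 1 ^ d := by
      simp [x]
    rw [hcoe, map_add, map_mul, map_add, map_pow, map_pow, h0, h1, h2, Nat.sub_add_cancel hN]
    change _ = x 0 ^ 2 + x 1 ^ 2 + x 2 ^ (d * (d - 1))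
    simp only [a, Matrix.cons_val]
    have hw : (-(κ c * x 2) ^ (d - 1)) ^ d = x 2 ^ (d * (d - 1)) := by
      rw [neg_pow, ← pow_mul, mul_comm (d - 1) d, mul_pow, ← map_pow, hc]
      rw [map_pow, map_neg, map_one, ← mul_assoc, ← mul_pow]; simp
    have hq := qq_spec d (x 0 + κ i * x 1 - (κ c * x 2) ^ (d - 1)) ((κ c * x 2) ^ (d - 1))
    rw [hw] at hq
    linear_combination -hq - x 1 ^ 2 * hI

lemma milnor_part [CharZero K] {d : ℕ} (hd : 3 ≤ d) :
    milnorNumber (X 0 * (X 1 + X 2 ^ (d - 1)) + X 1 ^ d : MvPolynomial (Fin 3) K) =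
      d * (d - 1) - 1 := by
  let x : Fin 3 → MvPowerSeries (Fin 3) K := MvPowerSeries.X
  have hx : ∀ s, MvPowerSeries.constantCoeff (x s) = 0 := fun s =>
    MvPowerSeries.constantCoeff_X s
  have e1 : d - 1 ≠ 0 := by omega
  let a : Fin 3 → MvPowerSeries (Fin 3) K := ![x 0 - d * (x 1 - x 2 ^ (d - 1)) ^ (d - 1), x 1 - x 2 ^ (d - 1), x 2]
  let b : Fin 3 → MvPowerSeries (Fin 3) K := ![x 0 + d * x 1 ^ (d - 1), x 1 + x 2 ^ (d - 1), x 2]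
  have hE : ∃ e : MvPowerSeries (Fin 3) K ≃ₐ[K] MvPowerSeries (Fin 3) K, ∀ s, e (x s) = a s := by
    apply mkAut a b
    · intro s
      fin_cases s <;> simp [a, hx, e1]
    · intro s
      fin_cases s <;> simp [b, hx, e1]
    · intro φ hφ s
      have h0 : φ (x 0) = a 0 := hφ 0
      have h1 : φ (x 1) = a 1 := hφ 1
      have h2 : φ (x 2) = a 2 := hφ 2
      change _ = x s
      fin_cases s <;> simp only [b, Matrix.cons_val, Fin.zero_eta, Fin.mk_one, Fin.reduceFinMk, map_add, map_sub, map_mul, map_neg, map_pow, map_natCast, h0, h1, h2] <;>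
        simp only [a, Matrix.cons_val] <;> ring
    · intro φ hφ s
      have h0 : φ (x 0) = b 0 := hφ 0
      have h1 : φ (x 1) = b 1 := hφ 1
      have h2 : φ (x 2) = b 2 := hφ 2
      change _ = x s
      fin_cases s <;> simp only [a, Matrix.cons_val, Fin.zero_eta, Fin.mk_one, Fin.reduceFinMk, map_add, map_sub, map_mul, map_neg, map_pow, map_natCast, h0, h1, h2] <;>
        simp only [b, Matrix.cons_val, add_sub_cancel_right]
  obtain ⟨e, he⟩ := hE
  set N := d * (d - 1) - 1 with hN
  unfold milnorNumber
  let Λ : MvPowerSeries (Fin 3) K →ₗ[K] (Fin N → K) := LinearMap.pi fun i => MvPowerSeries.coeff (Finsupp.single 2 i.1)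
  have hJ : Ideal.map (e : MvPowerSeries (Fin 3) K →+* MvPowerSeries (Fin 3) K) (Ideal.span (Set.range fun j : Fin 3 =>
      ((pderiv j (X 0 * (X 1 + X 2 ^ (d - 1)) + X 1 ^ d : MvPolynomial (Fin 3) K) :
        MvPolynomial (Fin 3) K) : MvPowerSeries (Fin 3) K))) =
      Ideal.span {x 0, x 1, x 2 ^ N} := by
    have p0 : e ((pderiv 0 (X 0 * (X 1 + X 2 ^ (d - 1)) + X 1 ^ d : MvPolynomial (Fin 3) K) :
        MvPolynomial (Fin 3) K) : MvPowerSeries (Fin 3) K) = x 1 := by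
      have : ((pderiv 0 (X 0 * (X 1 + X 2 ^ (d - 1)) + X 1 ^ d : MvPolynomial (Fin 3) K) :
        MvPolynomial (Fin 3) K) : MvPowerSeries (Fin 3) K) = x 1 + x 2 ^ (d - 1) := by
        simp [pderiv_X, Derivation.leibniz_pow, x, coe_nat_ps]
      rw [this, map_add, map_pow, he, he]
      simp [a]
    have p1 : e ((pderiv 1 (X 0 * (X 1 + X 2 ^ (d - 1)) + X 1 ^ d : MvPolynomial (Fin 3) K) :
        MvPolynomial (Fin 3) K) : MvPowerSeries (Fin 3) K) = x 0 := by
      have : ((pderiv 1 (X 0 * (X 1 + X 2 ^ (d - 1)) + X 1 ^ d : MvPolynomial (Fin 3) K) :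
        MvPolynomial (Fin 3) K) : MvPowerSeries (Fin 3) K) = x 0 + d * x 1 ^ (d - 1) := by
        simp [pderiv_X, Derivation.leibniz_pow, x, coe_nat_ps]
      rw [this, map_add, map_mul, map_natCast, map_pow, he, he]
      simp [a]
    have p2 : e ((pderiv 2 (X 0 * (X 1 + X 2 ^ (d - 1)) + X 1 ^ d : MvPolynomial (Fin 3) K) :
        MvPolynomial (Fin 3) K) : MvPowerSeries (Fin 3) K) =
          (x 0 - d * (x 1 - x 2 ^ (d - 1)) ^ (d - 1)) * (((d - 1 : ℕ) : MvPowerSeries (Fin 3) K) * x 2 ^ (d - 2)) := by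
      have : ((pderiv 2 (X 0 * (X 1 + X 2 ^ (d - 1)) + X 1 ^ d : MvPolynomial (Fin 3) K) :
        MvPolynomial (Fin 3) K) : MvPowerSeries (Fin 3) K) =
          x 0 * (((d - 1 : ℕ) : MvPowerSeries (Fin 3) K) * x 2 ^ (d - 2)) := by
        have : d - 1 - 1 = d - 2 := by omega
        simp [pderiv_X, Derivation.leibniz_pow, x, this, coe_nat_ps]
      rw [this, map_mul, map_mul, map_natCast, map_pow, he, he]
      simp [a]
    obtain ⟨k, hk⟩ := sub_dvd_pow_sub_pow (x 1 - x 2 ^ (d - 1)) (- x 2 ^ (d - 1)) (d - 1)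
    have hk' : (x 1 - x 2 ^ (d - 1)) ^ (d - 1) = x 1 * k + (-1) ^ (d - 1) * x 2 ^ ((d - 1) * (d - 1)) := by
      rw [pow_mul, ← neg_pow]
      linear_combination hk
    have hNe : x 2 ^ ((d - 1) * (d - 1)) * x 2 ^ (d - 2) = x 2 ^ N := by
      rw [← pow_add]; congr 1
      obtain ⟨m, rfl⟩ := Nat.exists_eq_add_of_le hd
      rw [hN]
      have : (3 + m) - 1 = m + 2 := by omega
      have h2 : (3 + m) - 2 = m + 1 := by omega
      rw [this, h2]
      have : (3 + m) * (m + 2) = (m + 2) * (m + 2) + (m + 1) + 1 := by ring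
      omega
    let c : K := - (d * (-1) ^ (d - 1) * ((d - 1 : ℕ) : K))
    have hc : c ≠ 0 := by
      have h1 : (d : K) ≠ 0 := by exact_mod_cast (by omega : d ≠ 0)
      have h2 : ((d - 1 : ℕ) : K) ≠ 0 := by exact_mod_cast e1
      exact neg_ne_zero.2 (mul_ne_zero (mul_ne_zero h1 (pow_ne_zero _ (by simp))) h2)
    have hcκ : algebraMap K (MvPowerSeries (Fin 3) K) c = - (d * (-1) ^ (d - 1) * ((d - 1 : ℕ) : MvPowerSeries (Fin 3) K)) := by
      simp only [c, map_neg, map_mul, map_pow, map_one, map_natCast]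
    have p2' : (x 0 - d * (x 1 - x 2 ^ (d - 1)) ^ (d - 1)) * (((d - 1 : ℕ) : MvPowerSeries (Fin 3) K) * x 2 ^ (d - 2)) =
        ((d - 1 : ℕ) : MvPowerSeries (Fin 3) K) * x 2 ^ (d - 2) * x 0 - d * k * ((d - 1 : ℕ) : MvPowerSeries (Fin 3) K) * x 2 ^ (d - 2) * x 1 +
        algebraMap K (MvPowerSeries (Fin 3) K) c * x 2 ^ N := by
      rw [hk', hcκ, ← hNe]; ring
    rw [p2'] at p2
    rw [Ideal.map_span, ← Set.range_comp]
    apply le_antisymm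
    · rw [Ideal.span_le]
      have m0 : x 0 ∈ Ideal.span {x 0, x 1, x 2 ^ N} := Ideal.subset_span (by simp)
      have m1 : x 1 ∈ Ideal.span {x 0, x 1, x 2 ^ N} := Ideal.subset_span (by simp)
      have m2 : x 2 ^ N ∈ Ideal.span {x 0, x 1, x 2 ^ N} := Ideal.subset_span (by simp)
      rintro _ ⟨j, rfl⟩
      fin_cases j
      · exact p0 ▸ m1
      · exact p1 ▸ m0
      · change e _ ∈ Ideal.span {x 0, x 1, x 2 ^ N}
        refine (congrArg (· ∈ Ideal.span {x 0, x 1, x 2 ^ N}) p2).mpr ?_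
        exact Ideal.add_mem _ (Ideal.sub_mem _ (Ideal.mul_mem_left _ _ m0) (Ideal.mul_mem_left _ _ m1))
          (Ideal.mul_mem_left _ _ m2)
    · set J := Ideal.span (Set.range ((e : MvPowerSeries (Fin 3) K →+* MvPowerSeries (Fin 3) K) ∘ fun j : Fin 3 =>
        ((pderiv j (X 0 * (X 1 + X 2 ^ (d - 1)) + X 1 ^ d : MvPolynomial (Fin 3) K) :
        MvPolynomial (Fin 3) K) : MvPowerSeries (Fin 3) K))) with hJ
      have m1 : x 1 ∈ J := Ideal.subset_span ⟨0, p0⟩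
      have m0 : x 0 ∈ J := Ideal.subset_span ⟨1, p1⟩
      have m2 : ((d - 1 : ℕ) : MvPowerSeries (Fin 3) K) * x 2 ^ (d - 2) * x 0 -
          d * k * ((d - 1 : ℕ) : MvPowerSeries (Fin 3) K) * x 2 ^ (d - 2) * x 1 +
          algebraMap K (MvPowerSeries (Fin 3) K) c * x 2 ^ N ∈ J := Ideal.subset_span ⟨2, p2⟩
      have m2' := (Ideal.add_mem_iff_right J (Ideal.sub_mem _ (Ideal.mul_mem_left _ _ m0) (Ideal.mul_mem_left _ _ m1))).1 m2
      have hu : IsUnit (algebraMap K (MvPowerSeries (Fin 3) K) c) := (IsUnit.mk0 c hc).map _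
      have m3 := (Ideal.unit_mul_mem_iff_mem J hu).1 m2'
      rw [Ideal.span_le]
      rintro y (rfl | rfl | rfl)
      · exact m0
      · exact m1
      · exact m3
  apply finrankQuot _ N (Λ ∘ₗ e.toLinearMap)
  · rw [LinearMap.coe_comp]
    refine Function.Surjective.comp ?_ e.surjective
    intro v
    obtain ⟨f, hf⟩ := monoSurj N v
    exact ⟨f, funext hf⟩
  · intro y
    have h1 : (Λ ∘ₗ e.toLinearMap) y = 0 ↔ e y ∈ Ideal.span {x 0, x 1, x 2 ^ N} := by
      rw [← monoKer, funext_iff]; rfl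
    rw [h1, ← hJ]
    constructor
    · intro h
      obtain ⟨z, hz, hzy⟩ := (Ideal.mem_map_iff_of_surjective (e : MvPowerSeries (Fin 3) K →+* MvPowerSeries (Fin 3) K) e.surjective).1 h
      have : z = y := e.injective hzy
      exact this ▸ hz
    · exact fun h => Ideal.mem_map_of_mem (e : MvPowerSeries (Fin 3) K →+* MvPowerSeries (Fin 3) K) h

/-- the surface `Z(x₀(x₁x₂^{d-2} + x₃^{d-1}) + x₁^d)` is singular at
`(0:0:1:0)`, the tangent cone `f_{d-1} = x₁x₂^{d-2} + x₃^{d-1}` and `f_d = x₁^d` meet at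
`(0:1:0)` with multiplicity `d(d-1)`, and `(0:0:1:0)` is an `A_{d(d-1)-1}` singularity,
achieving the maximal Milnor number `d(d-1) - 1`. -/
theorem stmt13 [CharZero K] [IsAlgClosed K] {d : ℕ} (hd : 3 ≤ d) :
    SingularAt
        (X 0 * rename Fin.succ (X 0 * X 1 ^ (d - 2) + X 2 ^ (d - 1) : MvPolynomial (Fin 3) K) +
          rename Fin.succ (X 0 ^ d : MvPolynomial (Fin 3) K))
        (fun i => if i = 2 then 1 else 0) ∧
      interMult (X 0 * X 1 ^ (d - 2) + X 2 ^ (d - 1)) ((X 0 : MvPolynomial (Fin 3) K) ^ d)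
        (fun j => if j = 1 then 1 else 0) = ((d * (d - 1) : ℕ) : ℕ∞) ∧
      IsATypeSing
        (localEq
          (X 0 * rename Fin.succ (X 0 * X 1 ^ (d - 2) + X 2 ^ (d - 1) : MvPolynomial (Fin 3) K) +
            rename Fin.succ (X 0 ^ d : MvPolynomial (Fin 3) K))
          (fun i => if i = 2 then 1 else 0) 2)
        (d * (d - 1) - 1) ∧
      milnorNumber
        (localEq
          (X 0 * rename Fin.succ (X 0 * X 1 ^ (d - 2) + X 2 ^ (d - 1) : MvPolynomial (Fin 3) K) +
            rename Fin.succ (X 0 ^ d : MvPolynomial (Fin 3) K))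
          (fun i => if i = 2 then 1 else 0) 2) = d * (d - 1) - 1 := by
  rw [localEq_eq]
  exact ⟨sing_part hd, inter_part hd, type_part hd, milnor_part hd⟩
end
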